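/- Let M be a Riemannian three-manifold carrying a unit Killing field ξ, let τ be the function with ∇̃_X ξ = τ(X × ξ), and let p ∈ M. Then M admits a totally geodesic surface passing through p which is everywhere tangent to ξ if and only if there exists a geodesic through p in M on which τ vanishes identically and which is orthogonal to ξ at p. -/

import Mathlib

noncomputable section
open Real Set

/-- Points of the coordinate chart `ℝⁿ`. -/
abbrev Pt (n : ℕ) := Fin n → ℝ

/-- The `i`-th standard coordinate vector. -/
def stdb (n : ℕ) (i : Fin n) : Pt n := Pi.single i 1

/-- Riemannian metric data in coordinates: a field of symmetric bilinear forms. -/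
abbrev Met (n : ℕ) := Pt n → Fin n → Fin n → ℝ

/-- The inner product of the vectors `v`, `w` at the point `x`, with respect to `g`. -/
def minner {n : ℕ} (g : Met n) (x v w : Pt n) : ℝ := ∑ i, ∑ j, g x i j * v i * w j

/-- `g` is a smooth Riemannian metric on `U`. -/
def IsMetricOn {n : ℕ} (U : Set (Pt n)) (g : Met n) : Prop :=
  (∀ i j, ContDiffOn ℝ (⊤ : ℕ∞) (fun x => g x i j) U) ∧
  (∀ x i j, g x i j = g x j i) ∧
  (∀ x ∈ U, ∀ v : Pt n, v ≠ 0 → 0 < minner g x v v)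

/-- The inverse metric `g^{kl}`. -/
def ginv {n : ℕ} (g : Met n) (x : Pt n) : Fin n → Fin n → ℝ :=
  fun k l => (Matrix.of (g x))⁻¹ k l

/-- The Christoffel symbols `Γᵏᵢⱼ` of the Levi-Civita connection of `g`. -/
def christoffel {n : ℕ} (g : Met n) (x : Pt n) (k i j : Fin n) : ℝ :=
  (1/2) * ∑ l, ginv g x k l *
    (fderiv ℝ (fun y => g y j l) x (stdb n i) + fderiv ℝ (fun y => g y i l) x (stdb n j)
      - fderiv ℝ (fun y => g y i j) x (stdb n l))

/-- The covariant derivative (Levi-Civita connection of `g`) of the vector field `Y`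
at the point `x` in the direction `v`. -/
def covD {n : ℕ} (g : Met n) (Y : Pt n → Pt n) (x v : Pt n) : Pt n :=
  fun k => fderiv ℝ (fun y => Y y k) x v + ∑ i, ∑ j, christoffel g x k i j * v i * Y x j

/-- `X` is a Killing field of `g` on `U`. -/
def IsKillingOn {n : ℕ} (U : Set (Pt n)) (g : Met n) (X : Pt n → Pt n) : Prop :=
  ∀ x ∈ U, ∀ v w : Pt n,
    minner g x (covD g X x v) w + minner g x (covD g X x w) v = 0

/-- `X` has unit length on `U`. -/
def IsUnitOn {n : ℕ} (U : Set (Pt n)) (g : Met n) (X : Pt n → Pt n) : Prop :=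
  ∀ x ∈ U, minner g x (X x) (X x) = 1

/-- The Lie bracket `[X,Y]` of two vector fields, in coordinates. -/
def lieB {n : ℕ} (X Y : Pt n → Pt n) (x : Pt n) : Pt n :=
  fun k => fderiv ℝ (fun y => Y y k) x (X x) - fderiv ℝ (fun y => X y k) x (Y x)

/-- A parametrized hypersurface `F : V → ℝ^{n+1}` with a chosen unit normal field `N`. -/
structure Hyp (n : ℕ) where
  V : Set (Pt n)
  F : Pt n → Pt (n+1)
  N : Pt n → Pt (n+1)

/-- The ambient covariant derivative, along the map `F`, of the ambient-vector-valued
field `W` defined on the parameter domain, in the coordinate direction `v`. -/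
def covAlong {n : ℕ} (g : Met (n+1)) (F W : Pt n → Pt (n+1)) (u v : Pt n) : Pt (n+1) :=
  fun k => fderiv ℝ (fun y => W y k) u v +
    ∑ i, ∑ j, christoffel g (F u) k i j * fderiv ℝ F u v i * W u j

/-- `S` is a smooth immersed hypersurface inside the chart `U`, with unit normal `N`. -/
def Hyp.IsRegular {n : ℕ} (S : Hyp n) (U : Set (Pt (n+1))) (g : Met (n+1)) : Prop :=
  IsOpen S.V ∧ ContDiffOn ℝ (⊤ : ℕ∞) S.F S.V ∧ (∀ u ∈ S.V, S.F u ∈ U) ∧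
  (∀ u ∈ S.V, LinearIndependent ℝ (fun a : Fin n => fderiv ℝ S.F u (stdb n a))) ∧
  ContDiffOn ℝ (⊤ : ℕ∞) S.N S.V ∧
  (∀ u ∈ S.V, minner g (S.F u) (S.N u) (S.N u) = 1) ∧
  (∀ u ∈ S.V, ∀ a : Fin n, minner g (S.F u) (S.N u) (fderiv ℝ S.F u (stdb n a)) = 0)

/-- `S` is totally geodesic: the shape operator `X ↦ -∇̃_X N` vanishes. -/
def Hyp.TotallyGeodesic {n : ℕ} (S : Hyp n) (g : Met (n+1)) : Prop :=
  ∀ u ∈ S.V, ∀ a : Fin n, covAlong g S.F S.N u (stdb n a) = 0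

/-- `S` is totally umbilical: the shape operator `X ↦ -∇̃_X N` is pointwise a
multiple of the identity. -/
def Hyp.TotallyUmbilical {n : ℕ} (S : Hyp n) (g : Met (n+1)) : Prop :=
  ∃ lam : Pt n → ℝ, ∀ u ∈ S.V, ∀ a : Fin n,
    covAlong g S.F S.N u (stdb n a) = lam u • fderiv ℝ S.F u (stdb n a)

/-- Projection onto the first `n` coordinates. -/
def projBase {n : ℕ} (x : Pt (n+1)) : Pt n := fun i => x i.castSucc

/-- The product metric of `g₀` with the Euclidean line (last coordinate). -/
def prodMet {n : ℕ} (g₀ : Met n) : Met (n+1) := fun x i j =>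
  Fin.lastCases (Fin.lastCases 1 (fun _ => 0) j)
    (fun i' => Fin.lastCases 0 (fun j' => g₀ (projBase x) i' j') j) i

/-- The coordinate domain of a product `𝕄 × I`. -/
def prodDom {n : ℕ} (U₀ : Set (Pt n)) (I : Set ℝ) : Set (Pt (n+1)) :=
  {x | projBase x ∈ U₀ ∧ x (Fin.last n) ∈ I}

/-- The unit vertical field `ξ` of a product `𝕄 × I`. -/
def vert (n : ℕ) : Pt (n+1) → Pt (n+1) := fun _ => stdb (n+1) (Fin.last n)

/-- The pullback of the metric `g` under the map `Φ`. -/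
def pullMet {n : ℕ} (g : Met n) (Φ : Pt n → Pt n) : Met n :=
  fun x i j => minner g (Φ x) (fderiv ℝ Φ x (stdb n i)) (fderiv ℝ Φ x (stdb n j))

/-- `g` has, on the coordinate domain `W`, the shape `dt² + f(t)² g_M` of a warped
product of an interval (the `0`-th coordinate) with an `n`-dimensional manifold. -/
def IsWarpedForm {n : ℕ} (g : Met (n+1)) (W : Set (Pt (n+1))) : Prop :=
  ∃ f : ℝ → ℝ, ContDiff ℝ (⊤ : ℕ∞) f ∧ (∀ t, 0 < f t) ∧
    ∀ x ∈ W, g x 0 0 = 1 ∧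
      (∀ i : Fin (n+1), i ≠ 0 → g x 0 i = 0 ∧ g x i 0 = 0) ∧
      (∀ i j : Fin (n+1), i ≠ 0 → j ≠ 0 →
        fderiv ℝ (fun y => g y i j / f (y 0) ^ 2) x (stdb (n+1) 0) = 0)

/-- The Riemannian manifold `(U₀, g₀)` has, in a neighborhood of `p`, the structure of a
warped product of an interval of the Euclidean line with an `n`-dimensional manifold:
there is a diffeomorphism `Φ` from a coordinate domain `W` onto a neighborhood of `p`
pulling `g₀` back to a warped-product metric. -/
def LocallyWarpedAt {n : ℕ} (U₀ : Set (Pt (n+1))) (g₀ : Met (n+1)) (p : Pt (n+1)) : Prop :=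
  ∃ (W : Set (Pt (n+1))) (Φ Ψ : Pt (n+1) → Pt (n+1)),
    IsOpen W ∧ ContDiffOn ℝ (⊤ : ℕ∞) Φ W ∧ MapsTo Φ W U₀ ∧
    IsOpen (Φ '' W) ∧ p ∈ Φ '' W ∧
    ContDiffOn ℝ (⊤ : ℕ∞) Ψ (Φ '' W) ∧ (∀ w ∈ W, Ψ (Φ w) = w) ∧
    IsWarpedForm (pullMet g₀ Φ) W

/-- The Levi-Civita symbol on three indices. -/
def lcSymb (i j k : Fin 3) : ℝ :=
  ((j.val : ℝ) - (i.val : ℝ)) * ((k.val : ℝ) - (i.val : ℝ)) * ((k.val : ℝ) - (j.val : ℝ)) / 2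

/-- The cross product of `v` and `w` at `x`, with respect to the metric `g` and the
orientation of the chart. -/
def crossG (g : Met 3) (x v w : Pt 3) : Pt 3 :=
  fun k => Real.sqrt (Matrix.det (Matrix.of (g x))) *
    ∑ l, ginv g x k l * ∑ i, ∑ j, lcSymb l i j * v i * w j

/-- The components `Rˡᵢⱼₖ` of the Riemann curvature tensor
(`R(∂ᵢ,∂ⱼ)∂ₖ = Rˡᵢⱼₖ ∂ₗ`, with `R(X,Y) = ∇_X∇_Y - ∇_Y∇_X - ∇_{[X,Y]}`). -/
def riem {n : ℕ} (g : Met n) (x : Pt n) (l i j k : Fin n) : ℝ :=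
  fderiv ℝ (fun y => christoffel g y l j k) x (stdb n i)
  - fderiv ℝ (fun y => christoffel g y l i k) x (stdb n j)
  + ∑ m, (christoffel g x l i m * christoffel g x m j k
      - christoffel g x l j m * christoffel g x m i k)

/-- The curvature operator `R(v,w)z` at `x`. -/
def riemVec {n : ℕ} (g : Met n) (x v w z : Pt n) : Pt n :=
  fun l => ∑ i, ∑ j, ∑ k, riem g x l i j k * v i * w j * z k

/-- `g` has constant sectional curvature `c` on `W`. -/
def HasConstCurv {n : ℕ} (W : Set (Pt n)) (g : Met n) (c : ℝ) : Prop :=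
  ∀ x ∈ W, ∀ v w : Pt n,
    minner g x (riemVec g x v w w) v
      = c * (minner g x v v * minner g x w w - (minner g x v w) ^ 2)

/-- The Ricci tensor of `g`. -/
def ricci {n : ℕ} (g : Met n) (x : Pt n) (j k : Fin n) : ℝ := ∑ i, riem g x i i j k

/-- The scalar curvature of `g`. -/
def scal {n : ℕ} (g : Met n) (x : Pt n) : ℝ := ∑ j, ∑ k, ginv g x j k * ricci g x j k

/-- The metric `dx² + sin²θ(x) dy² + cos²θ(x) dz²` on a three-dimensional chart. -/
def tgMet (θ : ℝ → ℝ) : Met 3 := fun x i j =>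
  if i = j then
    (if i = 0 then 1 else if i = 1 then (Real.sin (θ (x 0))) ^ 2 else (Real.cos (θ (x 0))) ^ 2)
  else 0

/-- The warped product metric `dt² + f(t)² g₀` (interval coordinate first). -/
def warpMet {n : ℕ} (f : ℝ → ℝ) (g₀ : Met n) : Met (n+1) := fun x i j =>
  Fin.cases (Fin.cases 1 (fun _ => 0) j)
    (fun i' => Fin.cases 0 (fun j' => f (x 0) ^ 2 * g₀ (Fin.tail x) i' j') j) i

/-- The coordinate domain of a warped product `I ×_f 𝕄` (interval coordinate first). -/
def warpDom {n : ℕ} (I : Set ℝ) (U₀ : Set (Pt n)) : Set (Pt (n+1)) :=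
  {x | x 0 ∈ I ∧ Fin.tail x ∈ U₀}

/-- The covariant acceleration of a curve `γ`, whose vanishing defines geodesics. -/
def curveAccel {n : ℕ} (g : Met n) (γ : ℝ → Pt n) (s : ℝ) : Pt n :=
  fun k => deriv (fun t => deriv (fun r => γ r k) t) s +
    ∑ i, ∑ j, christoffel g (γ s) k i j * deriv (fun r => γ r i) s * deriv (fun r => γ r j) s

/-- The velocity of a curve. -/
def vel {n : ℕ} (γ : ℝ → Pt n) (s : ℝ) : Pt n := fun k => deriv (fun r => γ r k) s

section Flow

variable {E F : Type} [NormedAddCommGroup E] [NormedSpace ℝ E]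
  [NormedAddCommGroup F] [NormedSpace ℝ F]
  {K : Type} [TopologicalSpace K] [CompactSpace K]

/-- Pointwise application of a continuous family of operators to a continuous function. -/
def pointwiseApply : C(K, E →L[ℝ] F) →L[ℝ] C(K, E) →L[ℝ] C(K, F) :=
  LinearMap.mkContinuous₂
    (LinearMap.mk₂ ℝ (fun (A : C(K, E →L[ℝ] F)) (α : C(K, E)) =>
        (⟨fun t => A t (α t), by fun_prop⟩ : C(K, F)))
      (fun A B α => by ext; simp) (fun c A α => by ext; simp)
      (fun A α β => by ext; simp) (fun c A α => by ext; simp))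
    1 (fun A α => by
      rw [ContinuousMap.norm_le _ (by positivity)]
      intro t
      simp only [LinearMap.mk₂_apply, ContinuousMap.coe_mk, one_mul]
      exact (A t).le_of_opNorm_le_of_le (A.norm_coe_le_norm t) (α.norm_coe_le_norm t))

/-- The composition operator `α ↦ f ∘ α` is differentiable. -/
lemma hasFDerivAt_comp_continuousMap {f : E → F} (hf : ContDiff ℝ (⊤ : ℕ∞) f)
    (hc : HasCompactSupport f) (α : C(K, E)) :
    HasFDerivAt (fun β : C(K, E) => (⟨f, hf.continuous⟩ : C(E, F)).comp β)
      (pointwiseApply ((⟨fderiv ℝ f, hf.continuous_fderiv (by simp)⟩ : C(E, E →L[ℝ] F)).comp α))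
      α := by
  obtain ⟨C, hC⟩ := ContDiff.lipschitzWith_of_hasCompactSupport (hc.fderiv ℝ)
    (hf.fderiv_right (m := 1) (by norm_cast)) one_ne_zero
  have key : ∀ x y : E, ‖f y - f x - fderiv ℝ f x (y - x)‖ ≤ C * ‖y - x‖ ^ 2 := by
    intro x y
    have h := (convex_segment (𝕜 := ℝ) x y).norm_image_sub_le_of_norm_fderiv_le' (𝕜 := ℝ) (f := f)
      (φ := fderiv ℝ f x) (C := C * ‖y - x‖)
      (fun z _ => (hf.differentiable (by simp)).differentiableAt) (fun z hz => by
        refine (hC.norm_sub_le z x).trans ?_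
        gcongr
        obtain ⟨t, ht, rfl⟩ := (segment_eq_image' ℝ x y) ▸ hz
        rw [add_sub_cancel_left, norm_smul, Real.norm_of_nonneg ht.1]
        exact mul_le_of_le_one_left (norm_nonneg _) ht.2)
      (left_mem_segment ℝ x y) (right_mem_segment ℝ x y)
    rw [sq, ← mul_assoc]; exact h
  rw [hasFDerivAt_iff_isLittleO_nhds_zero]
  refine Asymptotics.IsBigO.trans_isLittleO (g := fun h : C(K, E) => ‖h‖ ^ 2) ?_ ?_
  · refine Asymptotics.IsBigO.of_bound C (Filter.Eventually.of_forall fun h => ?_)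
    rw [ContinuousMap.norm_le _ (by positivity)]
    intro t
    have := key (α t) (α t + h t)
    simp only [add_sub_cancel_left] at this
    refine this.trans ?_
    rw [norm_pow, norm_norm]
    gcongr
    exact h.norm_coe_le_norm t
  · exact (Asymptotics.isLittleO_norm_pow_id one_lt_two)

lemma contDiff_nat_comp_continuousMap (n : ℕ) :
    ∀ {F : Type} [NormedAddCommGroup F] [NormedSpace ℝ F] {f : E → F}
    (hf : ContDiff ℝ (⊤ : ℕ∞) f) (_ : HasCompactSupport f),
    ContDiff ℝ n (fun β : C(K, E) => (⟨f, hf.continuous⟩ : C(E, F)).comp β) := by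
  induction n with
  | zero =>
    intro F _ _ f hf hc
    exact contDiff_zero.2 (ContinuousMap.continuous_postcomp _)
  | succ n ih =>
    intro F _ _ f hf hc
    push_cast
    rw [contDiff_succ_iff_hasFDerivAt]
    have h1 := ih (hf.fderiv_right (m := (⊤ : ℕ∞)) (by norm_cast)) (hc.fderiv ℝ)
    let P : C(K, E →L[ℝ] F) →L[ℝ] C(K, E) →L[ℝ] C(K, F) := pointwiseApply
    have h2 := P.contDiff.comp h1
    exact ⟨_, h2, fun α => hasFDerivAt_comp_continuousMap hf hc α⟩

/-- The composition operator `α ↦ f ∘ α` is smooth. -/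
lemma contDiff_comp_continuousMap {f : E → F} (hf : ContDiff ℝ (⊤ : ℕ∞) f)
    (hc : HasCompactSupport f) :
    ContDiff ℝ (⊤ : ℕ∞) (fun β : C(K, E) => (⟨f, hf.continuous⟩ : C(E, F)).comp β) :=
  contDiff_infty.2 fun n => contDiff_nat_comp_continuousMap n hf hc

/-- The primitive vanishing at `0`, as an operator on continuous functions on `[-1, 1]`. -/
def primitiveOp : C(Icc (-1 : ℝ) 1, E) →L[ℝ] C(Icc (-1 : ℝ) 1, E) :=
  LinearMap.mkContinuous
    { toFun := fun β => ⟨fun r => ∫ u in (0 : ℝ)..r, IccExtend (by norm_num) β u,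
        (intervalIntegral.continuous_primitive (fun a b =>
          (β.continuous.Icc_extend' (h := by norm_num)).intervalIntegrable a b) 0).comp
          continuous_subtype_val⟩
      map_add' := fun β β' => by
        ext r
        simp only [ContinuousMap.coe_mk, ContinuousMap.add_apply]
        rw [← intervalIntegral.integral_add
          ((β.continuous.Icc_extend' (h := by norm_num)).intervalIntegrable _ _)
          ((β'.continuous.Icc_extend' (h := by norm_num)).intervalIntegrable _ _)]
        rfl
      map_smul' := fun c β => by
        ext r
        simp only [ContinuousMap.coe_mk, ContinuousMap.smul_apply, RingHom.id_apply]
        rw [← intervalIntegral.integral_smul]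
        rfl }
    1 (fun β => by
      rw [ContinuousMap.norm_le _ (by positivity)]
      intro r
      simp only [LinearMap.coe_mk, AddHom.coe_mk, ContinuousMap.coe_mk]
      refine (intervalIntegral.norm_integral_le_of_norm_le_const (C := ‖β‖)
        (fun u _ => β.norm_coe_le_norm _)).trans ?_
      rw [sub_zero, one_mul]
      exact mul_le_of_le_one_right (norm_nonneg _) (abs_le.2 r.2))

lemma norm_primitiveOp_le (β : C(Icc (-1 : ℝ) 1, E)) : ‖primitiveOp β‖ ≤ ‖β‖ := by
  simpa using (primitiveOp (E := E)).le_of_opNorm_le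
    (LinearMap.mkContinuous_norm_le _ zero_le_one _) β

end Flow

/-- A smooth Lipschitz-small perturbation of the identity has a smooth global inverse. -/
lemma exists_contDiff_inverse_of_near_id {X : Type} [NormedAddCommGroup X] [NormedSpace ℝ X]
    [CompleteSpace X] [Nontrivial X] {H : X → X} (hH : ContDiff ℝ (⊤ : ℕ∞) H) {c : NNReal}
    (hc : c < 1) (h : ∀ a b, ‖H a - H b - (a - b)‖ ≤ c * ‖a - b‖) :
    ∃ G : X → X, ContDiff ℝ (⊤ : ℕ∞) G ∧ (∀ a, G (H a) = a) ∧ ∀ b, H (G b) = b := by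
  have happ : ApproximatesLinearOn H
      ((ContinuousLinearEquiv.refl ℝ X : X ≃L[ℝ] X) : X →L[ℝ] X) univ c :=
    fun a _ b _ => by simpa using h a b
  have hN : ‖((ContinuousLinearEquiv.refl ℝ X).symm : X →L[ℝ] X)‖₊ = 1 := by
    ext; simp
  let e := happ.toHomeomorph H (Or.inr (by rw [hN]; simpa using hc))
  have hsmall : ∀ a, ‖ContinuousLinearMap.id ℝ X - fderiv ℝ H a‖ < 1 := fun a => by
    have hd : HasFDerivAt (fun x => x - H x) (ContinuousLinearMap.id ℝ X - fderiv ℝ H a) a :=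
      (hasFDerivAt_id a).sub ((hH.differentiable (by simp)) a).hasFDerivAt
    refine lt_of_le_of_lt (hd.le_of_lip' c.coe_nonneg (.of_forall fun x => ?_))
      (by exact_mod_cast hc)
    rw [show x - H x - (a - H a) = -(H x - H a - (x - a)) by abel, norm_neg]
    exact h x a
  let D : X → X ≃L[ℝ] X := fun a => ContinuousLinearEquiv.ofUnit (Units.oneSub _ (hsmall a))
  have hD : ∀ a, ((D a : X ≃L[ℝ] X) : X →L[ℝ] X) = fderiv ℝ H a := fun a => by
    change (1 : X →L[ℝ] X) - (ContinuousLinearMap.id ℝ X - fderiv ℝ H a) = _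
    change (1 : X →L[ℝ] X) - (1 - fderiv ℝ H a) = _
    abel
  have he : ∀ a, HasFDerivAt e (D a : X →L[ℝ] X) a := fun a => by
    rw [hD]; exact ((hH.differentiable (by simp)) a).hasFDerivAt
  exact ⟨e.symm, e.contDiff_symm he hH, e.symm_apply_apply, e.apply_symm_apply⟩

section Flow

variable {E : Type} [NormedAddCommGroup E] [NormedSpace ℝ E] [CompleteSpace E]

lemma exists_smooth_flow_of_small {f : E → E} (hf : ContDiff ℝ (⊤ : ℕ∞) f)
    (hs : HasCompactSupport f) {M L : NNReal} (hM : ∀ x, ‖f x‖ ≤ M) (hL : LipschitzWith L f)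
    (hML : M + L < 1) :
    ∃ φ : ℝ × E → E, ContDiffOn ℝ (⊤ : ℕ∞) φ (Ioo (-1) 1 ×ˢ univ) ∧ (∀ x, φ (0, x) = x) ∧
      ∀ t ∈ Ioo (-1 : ℝ) 1, ∀ x, HasDerivAt (fun t => φ (t, x)) (f (φ (t, x))) t := by
  let Cb := C(Icc (-1 : ℝ) 1, E)
  let comp : Cb → Cb := fun β => (⟨f, hf.continuous⟩ : C(E, E)).comp β
  have hcomp : ContDiff ℝ (⊤ : ℕ∞) comp := contDiff_comp_continuousMap hf hs
  let H : ℝ × Cb → ℝ × Cb := fun p => (p.1, p.2 - sin p.1 • primitiveOp (comp p.2))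
  have hH : ContDiff ℝ (⊤ : ℕ∞) H :=
    contDiff_fst.prodMk (contDiff_snd.sub ((Real.contDiff_sin.comp contDiff_fst).smul
      (primitiveOp.contDiff.comp (hcomp.comp contDiff_snd))))
  have hcM : ∀ β, ‖primitiveOp (comp β)‖ ≤ M := fun β =>
    (norm_primitiveOp_le _).trans ((ContinuousMap.norm_le _ M.coe_nonneg).2 fun t => hM _)
  have hcL : ∀ α β, ‖primitiveOp (comp α) - primitiveOp (comp β)‖ ≤ L * ‖α - β‖ := fun α β => by
    rw [← map_sub]
    refine (norm_primitiveOp_le _).trans ((ContinuousMap.norm_le _ (by positivity)).2 fun t => ?_)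
    refine (hL.norm_sub_le (α t) (β t)).trans ?_
    gcongr
    exact (α - β).norm_coe_le_norm t
  have hsin : ∀ a b : ℝ, |sin a - sin b| ≤ |a - b| := fun a b => by
    have := Real.abs_sin_sub_sin_le a b
    exact this
  obtain ⟨G, hG, hGH, hHG⟩ := exists_contDiff_inverse_of_near_id hH hML (fun a b => by
    have h1 : H a - H b - (a - b) = (0, -((sin a.1 - sin b.1) • primitiveOp (comp a.2)
        + sin b.1 • (primitiveOp (comp a.2) - primitiveOp (comp b.2)))) := by
      ext1
      · simp [H]
      · simp only [H, Prod.snd_sub]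
        module
    rw [h1, Prod.norm_def, norm_zero, norm_neg, max_eq_right (norm_nonneg _)]
    refine (norm_add_le _ _).trans ?_
    rw [norm_smul, norm_smul, Real.norm_eq_abs, Real.norm_eq_abs]
    calc |sin a.1 - sin b.1| * ‖primitiveOp (comp a.2)‖
          + |sin b.1| * ‖primitiveOp (comp a.2) - primitiveOp (comp b.2)‖
        ≤ ‖a - b‖ * M + 1 * (L * ‖a - b‖) := by
          gcongr
          · exact (hsin _ _).trans (norm_fst_le (a - b))
          · exact hcM _
          · exact Real.abs_sin_le_one _
          · refine (hcL _ _).trans ?_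
            gcongr
            exact norm_snd_le (a - b)
      _ = _ := by push_cast; ring)
  let sol : ℝ → E → Cb := fun t x => (G (t, ContinuousMap.const _ x)).2
  have hsol : ∀ t x, sol t x = ContinuousMap.const _ x + sin t • primitiveOp (comp (sol t x)) := by
    intro t x
    have h := hHG (t, ContinuousMap.const _ x)
    have h1 : (G (t, ContinuousMap.const _ x)).1 = t := congrArg Prod.fst h
    have h2 := congrArg Prod.snd h
    simp only [H, h1] at h2
    exact sub_eq_iff_eq_add.1 h2
  have huniq : ∀ t x (β : Cb), β = ContinuousMap.const _ x + sin t • primitiveOp (comp β) →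
      sol t x = β := by
    intro t x β hβ
    have : H (t, β) = (t, ContinuousMap.const _ x) := by
      ext1
      · rfl
      · exact sub_eq_iff_eq_add.2 hβ
    simp only [sol, ← this, hGH]
  let y : E → Cb := fun x => sol (π / 2) x
  have hy : ∀ x, y x = ContinuousMap.const _ x + primitiveOp (comp (y x)) := fun x => by
    have := hsol (π / 2) x
    rwa [Real.sin_pi_div_two, one_smul] at this
  have h11 : (-1 : ℝ) ≤ 1 := by norm_num
  have hyt : ∀ x, ∀ t ∈ Icc (-1 : ℝ) 1,
      IccExtend h11 (y x) t = x + ∫ u in (0 : ℝ)..t, f (IccExtend h11 (y x) u) := by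
    intro x t ht
    rw [IccExtend_of_mem _ _ ht]
    exact DFunLike.congr_fun (hy x) ⟨t, ht⟩
  let e1 : Icc (-1 : ℝ) 1 := ⟨1, by norm_num⟩
  have hscale : ∀ x, ∀ t ∈ Icc (-1 : ℝ) 1, sol (arcsin t) x e1 = IccExtend h11 (y x) t := by
    intro x t ht
    let β : Cb := ⟨fun r => IccExtend h11 (y x) (r * t),
      ((y x).continuous.Icc_extend' (h := h11)).comp (by fun_prop)⟩
    have hmem : ∀ r ∈ Icc (-1 : ℝ) 1, r * t ∈ Icc (-1 : ℝ) 1 := fun r hr => by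
      rw [mem_Icc, ← abs_le] at *
      rw [abs_mul]
      exact mul_le_one₀ hr (abs_nonneg _) ht
    have hβ : sol (arcsin t) x = β := by
      refine huniq _ _ _ ?_
      rw [Real.sin_arcsin ht.1 ht.2]
      ext r
      change IccExtend h11 (y x) (r * t) =
        x + t • ∫ u in (0 : ℝ)..r, IccExtend h11 (comp β) u
      rw [hyt x _ (hmem r r.2)]
      congr 1
      rw [show (∫ u in (0 : ℝ)..r, IccExtend h11 (comp β) u) =
        ∫ u in (0 : ℝ)..r, f (IccExtend h11 (y x) (u * t)) from ?_]
      · rw [intervalIntegral.smul_integral_comp_mul_right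
          (fun u => f (IccExtend h11 (y x) u)), zero_mul]
      · refine intervalIntegral.integral_congr fun u hu => ?_
        have hu' : u ∈ Icc (-1 : ℝ) 1 := by
          have h0 : (0 : ℝ) ∈ Icc (-1 : ℝ) 1 := by norm_num
          exact (uIcc_subset_Icc h0 r.2) hu
        simp only [IccExtend_of_mem _ _ hu']
        rfl
    rw [hβ]
    change IccExtend h11 (y x) (1 * t) = _
    rw [one_mul]
  refine ⟨fun p => sol (arcsin p.1) p.2 e1, ?_, fun x => ?_, fun t ht x => ?_⟩
  · have harc : ContDiffOn ℝ (⊤ : ℕ∞) (fun p : ℝ × E => arcsin p.1) (Ioo (-1) 1 ×ˢ univ) := by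
      intro p hp
      exact ((Real.contDiffAt_arcsin hp.1.1.ne' hp.1.2.ne).comp p contDiffAt_fst).contDiffWithinAt
    have hconst : ContDiff ℝ (⊤ : ℕ∞) (fun x : E => (ContinuousMap.const _ x : Cb)) := by
      refine IsBoundedLinearMap.contDiff ⟨⟨fun x y => rfl, fun c x => rfl⟩, 1, one_pos, fun x => ?_⟩
      rw [one_mul]
      exact (ContinuousMap.norm_le _ (norm_nonneg _)).2 fun _ => le_rfl
    exact ((ContinuousMap.evalCLM ℝ e1).contDiff.comp contDiff_snd).comp_contDiffOn
      (hG.comp_contDiffOn (harc.prodMk (hconst.comp contDiff_snd).contDiffOn))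
  · simp only
    rw [hscale x 0 (by norm_num), hyt x 0 (by norm_num)]
    simp
  · have hcont : Continuous fun u => f (IccExtend h11 (y x) u) :=
      hf.continuous.comp ((y x).continuous.Icc_extend' (h := h11))
    have hd : HasDerivAt (fun t => x + ∫ u in (0 : ℝ)..t, f (IccExtend h11 (y x) u))
        (f (IccExtend h11 (y x) t)) t :=
      (intervalIntegral.integral_hasDerivAt_right (hcont.intervalIntegrable _ _)
        hcont.stronglyMeasurable.stronglyMeasurableAtFilter hcont.continuousAt).const_add x
    simp only
    rw [hscale x t (Ioo_subset_Icc_self ht)]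
    refine hd.congr_of_eventuallyEq ?_
    filter_upwards [isOpen_Ioo.mem_nhds ht] with s hs
    rw [hscale x s (Ioo_subset_Icc_self hs), hyt x s (Ioo_subset_Icc_self hs)]

/-- A vector field which is smooth on an open set has a smooth local flow. -/
lemma exists_smooth_local_flow [FiniteDimensional ℝ E] {U : Set E} (hU : IsOpen U) {f : E → E}
    (hf : ContDiffOn ℝ (⊤ : ℕ∞) f U) {x₀ : E} (hx₀ : x₀ ∈ U) :
    ∃ (δ : ℝ) (φ : ℝ × E → E), 0 < δ ∧
      ContDiffOn ℝ (⊤ : ℕ∞) φ (Ioo (-δ) δ ×ˢ Metric.ball x₀ δ) ∧ (∀ x, φ (0, x) = x) ∧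
      ∀ t ∈ Ioo (-δ) δ, ∀ x ∈ Metric.ball x₀ δ,
        φ (t, x) ∈ U ∧ HasDerivAt (fun t => φ (t, x)) (f (φ (t, x))) t := by
  obtain ⟨χ, hχU⟩ : ∃ χ : ContDiffBump x₀, Metric.closedBall x₀ χ.rOut ⊆ U := by
    obtain ⟨r, hr, hrU⟩ := Metric.nhds_basis_closedBall.mem_iff.1 (hU.mem_nhds hx₀)
    exact ⟨⟨r / 2, r, by positivity, by linarith⟩, hrU⟩
  let h : E → E := fun x => χ x • f x
  have hh : ContDiff ℝ (⊤ : ℕ∞) h := by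
    refine contDiff_iff_contDiffAt.2 fun x => ?_
    by_cases hx : x ∈ tsupport χ
    · rw [χ.tsupport_eq] at hx
      exact χ.contDiffAt.smul (hf.contDiffAt (hU.mem_nhds (hχU hx)))
    · refine contDiffAt_const (c := (0 : E)) |>.congr_of_eventuallyEq ?_
      filter_upwards [(isClosed_tsupport _).isOpen_compl.mem_nhds hx] with z hz
      simp only [h, image_eq_zero_of_notMem_tsupport hz, zero_smul]
  have hhs : HasCompactSupport h := χ.hasCompactSupport.smul_right
  obtain ⟨L, hL⟩ := ContDiff.lipschitzWith_of_hasCompactSupport hhs hh (by simp)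
  obtain ⟨M, hM⟩ : ∃ M : NNReal, ∀ x, ‖h x‖ ≤ M := by
    obtain ⟨C, hC⟩ := hhs.exists_bound_of_continuous hh.continuous
    exact ⟨C.toNNReal, fun x => (hC x).trans (Real.le_coe_toNNReal C)⟩
  let ε : NNReal := (M + L + 1)⁻¹
  have hε : 0 < ε := inv_pos.2 (by positivity)
  have hεr : (0 : ℝ) < ε := hε
  obtain ⟨φ, hφs, hφ0, hφd⟩ := exists_smooth_flow_of_small (f := fun x => (ε : ℝ) • h x)
    (M := ε * M) (L := ε * L) (contDiff_const.smul hh) hhs.smul_left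
    (fun x => by
      rw [norm_smul, NNReal.norm_eq]
      push_cast
      exact mul_le_mul_of_nonneg_left (hM x) hεr.le)
    (LipschitzWith.of_dist_le_mul fun x y => by
      rw [dist_smul₀, NNReal.norm_eq]
      push_cast
      rw [mul_assoc]
      exact mul_le_mul_of_nonneg_left (hL.dist_le_mul x y) hεr.le)
    (by
      rw [← mul_add, mul_comm, ← div_eq_mul_inv, div_lt_one (by positivity)]
      exact lt_add_one _)
  let ψ : ℝ × E → E := fun p => φ (p.1 / ε, p.2)
  have hmem : ∀ t : ℝ, t ∈ Ioo (-(ε : ℝ)) ε → t / ε ∈ Ioo (-1 : ℝ) 1 := fun t ht => by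
    rw [mem_Ioo, lt_div_iff₀ hεr, div_lt_iff₀ hεr]
    exact ⟨by linarith [ht.1], by linarith [ht.2]⟩
  have hψs : ContDiffOn ℝ (⊤ : ℕ∞) ψ (Ioo (-(ε : ℝ)) ε ×ˢ univ) :=
    hφs.comp (((contDiff_fst.div_const _).prodMk contDiff_snd).contDiffOn)
      fun p hp => ⟨hmem _ hp.1, mem_univ _⟩
  have hψ0 : ∀ x, ψ (0, x) = x := fun x => by simp [ψ, hφ0]
  have hψd : ∀ t ∈ Ioo (-(ε : ℝ)) ε, ∀ x, HasDerivAt (fun t => ψ (t, x)) (h (ψ (t, x))) t := by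
    intro t ht x
    have := (hφd _ (hmem t ht) x).scomp t ((hasDerivAt_id t).div_const (ε : ℝ))
    rw [smul_smul, one_div, inv_mul_cancel₀ hεr.ne', one_smul] at this
    exact this
  have hopen : IsOpen (Ioo (-(ε : ℝ)) ε ×ˢ (univ : Set E)) := isOpen_Ioo.prod isOpen_univ
  have h0mem : ((0 : ℝ), x₀) ∈ Ioo (-(ε : ℝ)) ε ×ˢ (univ : Set E) :=
    ⟨⟨by linarith, hεr⟩, mem_univ _⟩
  have hcont : ContinuousAt ψ (0, x₀) :=
    hψs.continuousOn.continuousAt (hopen.mem_nhds h0mem)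
  have hnear : ψ ⁻¹' Metric.ball x₀ χ.rIn ∈ nhds ((0 : ℝ), x₀) := by
    refine hcont ?_
    rw [hψ0]
    exact Metric.ball_mem_nhds _ χ.rIn_pos
  obtain ⟨δ, hδ, hδs⟩ := Metric.mem_nhds_iff.1 (Filter.inter_mem hnear (hopen.mem_nhds h0mem))
  rw [← ball_prod_same, Real.ball_zero_eq_Ioo] at hδs
  refine ⟨δ, ψ, hδ, hψs.mono fun p hp => (hδs hp).2, hψ0, fun t ht x hx => ?_⟩
  have hball := (hδs (show (t, x) ∈ _ from ⟨ht, hx⟩)).1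
  refine ⟨hχU (Metric.ball_subset_closedBall
    (Metric.ball_subset_ball χ.rIn_lt_rOut.le hball)), ?_⟩
  have := hψd t (hδs (show (t, x) ∈ _ from ⟨ht, hx⟩)).2.1 x
  rwa [show h (ψ (t, x)) = f (ψ (t, x)) by
    simp only [h, χ.one_of_mem_closedBall (Metric.ball_subset_closedBall hball), one_smul]] at this

end Flow

section BilinearField

set_option maxSynthPendingDepth 3

variable {E : Type} [NormedAddCommGroup E] [NormedSpace ℝ E] {U : Set E}
  {G : E → E →L[ℝ] E →L[ℝ] ℝ} {Γ : E → E → E → E}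

lemma contDiffOn_sum_smul_const {ι κ F : Type} [Fintype ι] [Fintype κ] [NormedAddCommGroup F]
    [NormedSpace ℝ F] {a : E → ι → κ → ℝ} (c : ι → κ → F)
    (ha : ∀ i j, ContDiffOn ℝ (⊤ : ℕ∞) (fun x => a x i j) U) :
    ContDiffOn ℝ (⊤ : ℕ∞) (fun x => ∑ i, ∑ j, a x i j • c i j) U :=
  ContDiffOn.sum fun i _ => ContDiffOn.sum fun j _ => (ha i j).smul contDiffOn_const

lemma fderiv_sum_smul_const {ι κ F : Type} [Fintype ι] [Fintype κ] [NormedAddCommGroup F]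
    [NormedSpace ℝ F] {a : E → ι → κ → ℝ} (c : ι → κ → F) {x : E}
    (ha : ∀ i j, DifferentiableAt ℝ (fun x => a x i j) x) (u : E) :
    fderiv ℝ (fun x => ∑ i, ∑ j, a x i j • c i j) x u =
      ∑ i, ∑ j, fderiv ℝ (fun x => a x i j) x u • c i j := by
  have h : HasFDerivAt (fun x => ∑ i, ∑ j, a x i j • c i j)
      (∑ i, ∑ j, (fderiv ℝ (fun x => a x i j) x).smulRight (c i j)) x :=
    HasFDerivAt.fun_sum fun i _ => HasFDerivAt.fun_sum fun j _ => (ha i j).hasFDerivAt.smul_const _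
  rw [h.fderiv]
  simp

/-- Compatibility with the connection `Γ`, along a map. -/
lemma fderiv_bilin_comp {X : Type} [NormedAddCommGroup X] [NormedSpace ℝ X]
    {F V W : X → E} {u : X} (hG : DifferentiableAt ℝ G (F u))
    (hΓ : ∀ u' v w, G (F u) (Γ (F u) u' v) w + G (F u) v (Γ (F u) u' w)
      = fderiv ℝ G (F u) u' v w)
    (hF : DifferentiableAt ℝ F u) (hV : DifferentiableAt ℝ V u)
    (hW : DifferentiableAt ℝ W u) (v : X) :
    fderiv ℝ (fun y => G (F y) (V y) (W y)) u v =
      G (F u) (fderiv ℝ V u v + Γ (F u) (fderiv ℝ F u v) (V u)) (W u)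
        + G (F u) (V u) (fderiv ℝ W u v + Γ (F u) (fderiv ℝ F u v) (W u)) := by
  have h1 : HasFDerivAt (fun y => G (F y)) ((fderiv ℝ G (F u)).comp (fderiv ℝ F u)) u :=
    HasFDerivAt.comp (g := G) u hG.hasFDerivAt hF.hasFDerivAt
  rw [((h1.clm_apply hV.hasFDerivAt).clm_apply hW.hasFDerivAt).fderiv]
  have := hΓ (fderiv ℝ F u v) (V u) (W u)
  simp
  linarith

/-- The Lie derivative along a Killing field, as an evolution equation: the lowered
second-order term `Z + Γ(A, Y)` is transported along the integral curves of a Killing field. -/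
lemma hasDerivAt_bilin_add_christoffel (hU : IsOpen U) (hG : ContDiffOn ℝ (⊤ : ℕ∞) G U)
    (hs : ∀ x v w, G x v w = G x w v)
    (hΓ : ∀ x ∈ U, ∀ v w u, G x (Γ x v w) u = 1 / 2 * (fderiv ℝ G x v w u + fderiv ℝ G x w v u
      - fderiv ℝ G x u v w))
    {ξ : E → E} (hξ : ContDiffOn ℝ (⊤ : ℕ∞) ξ U)
    (hk : ∀ x ∈ U, ∀ v w, fderiv ℝ G x (ξ x) v w + G x (fderiv ℝ ξ x v) w
      + G x v (fderiv ℝ ξ x w) = 0)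
    {F A Y Z : ℝ → E} {t : ℝ} (hF : HasDerivAt F (ξ (F t)) t) (hFt : F t ∈ U)
    (hE : HasDerivAt A (fderiv ℝ ξ (F t) (A t)) t) (hY : HasDerivAt Y (fderiv ℝ ξ (F t) (Y t)) t)
    (hZ : HasDerivAt Z (fderiv ℝ (fderiv ℝ ξ) (F t) (A t) (Y t) + fderiv ℝ ξ (F t) (Z t)) t)
    (u : E) :
    HasDerivAt (fun s => G (F s) (Z s + Γ (F s) (A s) (Y s)) u)
      (-G (F t) (Z t + Γ (F t) (A t) (Y t)) (fderiv ℝ ξ (F t) u)) t := by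
  have hGs := hG.contDiffAt (hU.mem_nhds hFt)
  have hξs := hξ.contDiffAt (hU.mem_nhds hFt)
  have hDG : DifferentiableAt ℝ (fderiv ℝ G) (F t) :=
    (hGs.fderiv_right (m := 1) (by norm_cast)).differentiableAt one_ne_zero
  have hDξ : DifferentiableAt ℝ (fderiv ℝ ξ) (F t) :=
    (hξs.fderiv_right (m := 1) (by norm_cast)).differentiableAt one_ne_zero
  have hGd : DifferentiableAt ℝ G (F t) := hGs.differentiableAt (by simp)
  have hξd : DifferentiableAt ℝ ξ (F t) := hξs.differentiableAt (by simp)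
  have hGsymm : ∀ a b, fderiv ℝ (fderiv ℝ G) (F t) a b
      = fderiv ℝ (fderiv ℝ G) (F t) b a :=
    (hGs.isSymmSndFDerivAt (by simp; exact WithTop.coe_le_coe.2 le_top)).eq
  have hξsymm : ∀ a b, fderiv ℝ (fderiv ℝ ξ) (F t) a b = fderiv ℝ (fderiv ℝ ξ) (F t) b a :=
    (hξs.isSymmSndFDerivAt (by simp; exact WithTop.coe_le_coe.2 le_top)).eq
  have hk' : ∀ a v w, fderiv ℝ (fderiv ℝ G) (F t) a (ξ (F t)) v w
      + fderiv ℝ G (F t) (fderiv ℝ ξ (F t) a) v w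
      + fderiv ℝ G (F t) a (fderiv ℝ ξ (F t) v) w
      + G (F t) (fderiv ℝ (fderiv ℝ ξ) (F t) a v) w
      + fderiv ℝ G (F t) a v (fderiv ℝ ξ (F t) w)
      + G (F t) v (fderiv ℝ (fderiv ℝ ξ) (F t) a w) = 0 := by
    intro a v w
    have hd := ((((hDG.hasFDerivAt.clm_apply hξd.hasFDerivAt).clm_apply
      (hasFDerivAt_const v (F t))).clm_apply (hasFDerivAt_const w (F t))).add
      ((hGd.hasFDerivAt.clm_apply (hDξ.hasFDerivAt.clm_apply
      (hasFDerivAt_const v (F t)))).clm_apply (hasFDerivAt_const w (F t)))).add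
      ((hGd.hasFDerivAt.clm_apply (hasFDerivAt_const v (F t))).clm_apply
        (hDξ.hasFDerivAt.clm_apply (hasFDerivAt_const w (F t))))
    have h0 := (hasFDerivAt_const (𝕜 := ℝ) (0 : ℝ) (F t)).congr_of_eventuallyEq
      (Filter.eventually_of_mem (hU.mem_nhds hFt) fun z hz => hk z hz v w)
    have := DFunLike.congr_fun (hd.unique h0) a
    simp at this
    linarith
  have hloc : (fun s => G (F s) (Z s + Γ (F s) (A s) (Y s)) u) =ᶠ[nhds t] fun s =>
      G (F s) (Z s) u + 1 / 2 * (fderiv ℝ G (F s) (A s) (Y s) u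
        + fderiv ℝ G (F s) (Y s) (A s) u - fderiv ℝ G (F s) u (A s) (Y s)) := by
    filter_upwards [hF.continuousAt.preimage_mem_nhds (hU.mem_nhds hFt)] with s hFs
    rw [map_add, add_apply, hΓ _ hFs]
  refine HasDerivAt.congr_of_eventuallyEq ?_ hloc
  have hGF := hGd.hasFDerivAt.comp_hasDerivAt t hF
  have hDGF := hDG.hasFDerivAt.comp_hasDerivAt t hF
  have hu := hasDerivAt_const t u
  have hd := ((hGF.clm_apply hZ).clm_apply hu).add
    (((((hDGF.clm_apply hE).clm_apply hY).clm_apply hu).add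
      (((hDGF.clm_apply hY).clm_apply hE).clm_apply hu)).sub
      (((hDGF.clm_apply hu).clm_apply hE).clm_apply hY) |>.const_mul (1 / 2 : ℝ))
  refine hd.congr_deriv ?_
  simp only [map_add, add_apply, hΓ _ hFt, Function.comp_apply,
    map_zero, add_zero]
  have e1 := hk (F t) hFt (Z t) u
  have e2 := hk' (A t) (Y t) u
  have e3 := hk' (Y t) (A t) u
  have e4 := hk' u (A t) (Y t)
  rw [hξsymm (Y t) (A t)] at e3
  rw [hξsymm u (A t), hξsymm u (Y t), hs (F t) _ (Y t)] at e4
  rw [hGsymm (ξ (F t)) (A t), hGsymm (ξ (F t)) (Y t), hGsymm (ξ (F t)) u]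
  linear_combination e1 + 1 / 2 * (e2 + e3 - e4)

end BilinearField

section Metric

set_option maxSynthPendingDepth 3

variable {U : Set (Pt 3)} {g : Met 3} {x : Pt 3}

/-- The metric `g` as a field of continuous bilinear forms. -/
def metB (g : Met 3) (x : Pt 3) : Pt 3 →L[ℝ] Pt 3 →L[ℝ] ℝ :=
  ∑ i, ∑ j, g x i j • (ContinuousLinearMap.proj (R := ℝ) (φ := fun _ : Fin 3 => ℝ) i).smulRight
    (ContinuousLinearMap.proj (R := ℝ) (φ := fun _ : Fin 3 => ℝ) j)

lemma metB_apply (g : Met 3) (x v w : Pt 3) : metB g x v w = minner g x v w := by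
  simp [metB, minner, mul_assoc]

/-- The Christoffel symbols, contracted with two vectors. -/
def gam (g : Met 3) (x v w : Pt 3) : Pt 3 :=
  fun k => ∑ i, ∑ j, christoffel g x k i j * v i * w j

/-- The covariant derivative, along the map `F`, of the field `W`. -/
def cov {X : Type} [NormedAddCommGroup X] [NormedSpace ℝ X] (g : Met 3) (F W : X → Pt 3)
    (u v : X) : Pt 3 :=
  fderiv ℝ W u v + gam g (F u) (fderiv ℝ F u v) (W u)

lemma gam_add_left (g : Met 3) (x v v' w : Pt 3) :
    gam g x (v + v') w = gam g x v w + gam g x v' w := by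
  ext k
  simp only [gam, Pi.add_apply, ← Finset.sum_add_distrib]
  exact Finset.sum_congr rfl fun i _ => Finset.sum_congr rfl fun j _ => by ring

lemma gam_smul_left (g : Met 3) (x v w : Pt 3) (c : ℝ) :
    gam g x (c • v) w = c • gam g x v w := by
  ext k
  simp only [gam, Pi.smul_apply, smul_eq_mul, Finset.mul_sum]
  exact Finset.sum_congr rfl fun i _ => Finset.sum_congr rfl fun j _ => by ring

lemma IsMetricOn.contDiffOn_metB (hg : IsMetricOn U g) : ContDiffOn ℝ (⊤ : ℕ∞) (metB g) U :=
  contDiffOn_sum_smul_const _ hg.1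

lemma IsMetricOn.metB_symm (hg : IsMetricOn U g) (x v w : Pt 3) : metB g x v w = metB g x w v := by
  rw [metB_apply, metB_apply, minner, minner, Finset.sum_comm]
  exact Finset.sum_congr rfl fun i _ => Finset.sum_congr rfl fun j _ => by
    rw [hg.2.1 x j i]; ring

lemma IsMetricOn.eq_zero_of_metB_self (hg : IsMetricOn U g) (hx : x ∈ U) {v : Pt 3}
    (hv : metB g x v v = 0) : v = 0 := by
  by_contra h
  exact (hg.2.2 x hx v h).ne' (by rw [← metB_apply, hv])

lemma IsMetricOn.metB_self_pos (hg : IsMetricOn U g) (hx : x ∈ U) {v : Pt 3} (hv : v ≠ 0) :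
    0 < metB g x v v := by
  rw [metB_apply]; exact hg.2.2 x hx v hv

lemma IsMetricOn.isUnit_det (hg : IsMetricOn U g) (hx : x ∈ U) : IsUnit (Matrix.of (g x)).det := by
  rw [isUnit_iff_ne_zero]
  intro h
  obtain ⟨v, hv, hv0⟩ := Matrix.exists_mulVec_eq_zero_iff.2 h
  refine hv (hg.eq_zero_of_metB_self hx ?_)
  rw [metB_apply, minner]
  refine Finset.sum_eq_zero fun i _ => ?_
  have := congrFun hv0 i
  simp only [Matrix.mulVec, dotProduct, Matrix.of_apply, Pi.zero_apply] at this
  calc ∑ j, g x i j * v i * v j = v i * ∑ j, g x i j * v j := by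
        rw [Finset.mul_sum]; exact Finset.sum_congr rfl fun j _ => by ring
    _ = 0 := by rw [this, mul_zero]

lemma IsMetricOn.sum_mul_ginv (hg : IsMetricOn U g) (hx : x ∈ U) (b : Pt 3) (m : Fin 3) :
    ∑ k, g x m k * ∑ l, ginv g x k l * b l = b m := by
  have h : (Matrix.of (g x)).mulVec ((Matrix.of (g x))⁻¹.mulVec b) = b := by
    rw [Matrix.mulVec_mulVec, Matrix.mul_nonsing_inv _ (hg.isUnit_det hx), Matrix.one_mulVec]
  exact congrFun h m

lemma IsMetricOn.differentiableAt_metB (hg : IsMetricOn U g) (hU : IsOpen U) (hx : x ∈ U) :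
    DifferentiableAt ℝ (metB g) x :=
  (hg.contDiffOn_metB.contDiffAt (hU.mem_nhds hx)).differentiableAt (by simp)

lemma IsMetricOn.fderiv_metB_apply (hg : IsMetricOn U g) (hU : IsOpen U) (hx : x ∈ U)
    (u v w : Pt 3) :
    fderiv ℝ (metB g) x u v w =
      ∑ i, ∑ j, (∑ k, u k * fderiv ℝ (fun y => g y i j) x (stdb 3 k)) * v i * w j := by
  have hd : ∀ i j, DifferentiableAt ℝ (fun y => g y i j) x := fun i j =>
    ((hg.1 i j).contDiffAt (hU.mem_nhds hx)).differentiableAt (by simp)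
  have hu : u = ∑ k, u k • stdb 3 k := by
    ext k; simp [stdb, Pi.single_apply]
  have hk : ∀ i j, fderiv ℝ (fun y => g y i j) x u =
      ∑ k, u k * fderiv ℝ (fun y => g y i j) x (stdb 3 k) := fun i j => by
    conv_lhs => rw [hu, map_sum]
    simp only [map_smul, smul_eq_mul]
  have h := fderiv_sum_smul_const (a := g) (fun i j =>
    (ContinuousLinearMap.proj (R := ℝ) (φ := fun _ : Fin 3 => ℝ) i).smulRight
      (ContinuousLinearMap.proj (R := ℝ) (φ := fun _ : Fin 3 => ℝ) j)) hd u
  change fderiv ℝ (fun y => metB g y) x u = _ at h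
  rw [h]
  simp only [hk]
  simp [mul_assoc]

/-- The Koszul formula. -/
lemma IsMetricOn.metB_gam (hg : IsMetricOn U g) (hU : IsOpen U) (hx : x ∈ U) (v w u : Pt 3) :
    metB g x (gam g x v w) u = 1 / 2 * (fderiv ℝ (metB g) x v w u + fderiv ℝ (metB g) x w v u
      - fderiv ℝ (metB g) x u v w) := by
  let b : Pt 3 := fun l => ∑ i, ∑ j, 1 / 2 * (fderiv ℝ (fun y => g y j l) x (stdb 3 i)
    + fderiv ℝ (fun y => g y i l) x (stdb 3 j) - fderiv ℝ (fun y => g y i j) x (stdb 3 l))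
      * v i * w j
  have hgam : ∀ k, gam g x v w k = ∑ l, ginv g x k l * b l := fun k => by
    simp only [gam, christoffel, b, Fin.sum_univ_three]
    ring
  have h1 : metB g x (gam g x v w) u = ∑ m, b m * u m := by
    rw [hg.metB_symm, metB_apply, minner]
    refine Finset.sum_congr rfl fun m _ => ?_
    rw [← hg.sum_mul_ginv hx b m, Finset.sum_mul]
    exact Finset.sum_congr rfl fun k _ => by rw [hgam]; ring
  rw [h1, hg.fderiv_metB_apply hU hx, hg.fderiv_metB_apply hU hx, hg.fderiv_metB_apply hU hx]
  simp only [b, Fin.sum_univ_three]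
  ring

lemma IsMetricOn.fderiv_metB_symm (hg : IsMetricOn U g) (hU : IsOpen U) (hx : x ∈ U)
    (u v w : Pt 3) :
    fderiv ℝ (metB g) x u v w = fderiv ℝ (metB g) x u w v := by
  rw [hg.fderiv_metB_apply hU hx, hg.fderiv_metB_apply hU hx, Finset.sum_comm]
  refine Finset.sum_congr rfl fun i _ => Finset.sum_congr rfl fun j _ => ?_
  rw [show (fun y => g y j i) = fun y => g y i j from funext fun y => hg.2.1 y j i]
  ring

lemma IsMetricOn.metB_gam_add (hg : IsMetricOn U g) (hU : IsOpen U) (hx : x ∈ U) (u v w : Pt 3) :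
    metB g x (gam g x u v) w + metB g x v (gam g x u w) = fderiv ℝ (metB g) x u v w := by
  rw [hg.metB_symm x v, hg.metB_gam hU hx, hg.metB_gam hU hx]
  have h1 := hg.fderiv_metB_symm hU hx u w v
  have h2 := hg.fderiv_metB_symm hU hx v u w
  have h3 := hg.fderiv_metB_symm hU hx w v u
  linarith

/-- Metric compatibility of the covariant derivative along a map. -/
lemma IsMetricOn.fderiv_metB_comp (hg : IsMetricOn U g) (hU : IsOpen U) {X : Type}
    [NormedAddCommGroup X] [NormedSpace ℝ X]
    {F V W : X → Pt 3} {u : X} (hF : DifferentiableAt ℝ F u) (hV : DifferentiableAt ℝ V u)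
    (hW : DifferentiableAt ℝ W u) (hu : F u ∈ U) (v : X) :
    fderiv ℝ (fun y => metB g (F y) (V y) (W y)) u v =
      metB g (F u) (cov g F V u v) (W u) + metB g (F u) (V u) (cov g F W u v) :=
  fderiv_bilin_comp (Γ := gam g) (hg.differentiableAt_metB hU hu)
    (fun _ _ _ => hg.metB_gam_add hU hu _ _ _) hF hV hW v

lemma IsMetricOn.metB_cov_add_eq_zero (hg : IsMetricOn U g) (hU : IsOpen U) {X : Type}
    [NormedAddCommGroup X] [NormedSpace ℝ X]
    {F V W : X → Pt 3} {u : X} {c : ℝ} (hF : DifferentiableAt ℝ F u) (hV : DifferentiableAt ℝ V u)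
    (hW : DifferentiableAt ℝ W u) (hu : F u ∈ U)
    (hc : ∀ᶠ y in nhds u, metB g (F y) (V y) (W y) = c) (v : X) :
    metB g (F u) (cov g F V u v) (W u) + metB g (F u) (V u) (cov g F W u v) = 0 := by
  rw [← hg.fderiv_metB_comp hU hF hV hW hu, Filter.EventuallyEq.fderiv_eq (f := fun _ => c) hc]
  simp

/-- The Killing equation in terms of the Lie derivative of the metric. -/
lemma IsMetricOn.fderiv_metB_killing (hg : IsMetricOn U g) (hU : IsOpen U) {ξ : Pt 3 → Pt 3}
    (hk : ∀ x ∈ U, ∀ v w, metB g x (fderiv ℝ ξ x v + gam g x v (ξ x)) w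
      + metB g x (fderiv ℝ ξ x w + gam g x w (ξ x)) v = 0) (hx : x ∈ U) (v w : Pt 3) :
    fderiv ℝ (metB g) x (ξ x) v w + metB g x (fderiv ℝ ξ x v) w
      + metB g x v (fderiv ℝ ξ x w) = 0 := by
  have h := hk x hx v w
  rw [map_add, map_add, add_apply, add_apply, hg.metB_gam hU hx, hg.metB_gam hU hx] at h
  have h1 := hg.fderiv_metB_symm hU hx v w (ξ x)
  have h2 := hg.fderiv_metB_symm hU hx w v (ξ x)
  have h3 := hg.fderiv_metB_symm hU hx (ξ x) w v
  have h4 := hg.metB_symm x v (fderiv ℝ ξ x w)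
  linarith

/-- Transport of lowered second-order terms along a Killing field. -/
lemma IsMetricOn.hasDerivAt_metB_add_gam (hg : IsMetricOn U g) (hU : IsOpen U) {ξ : Pt 3 → Pt 3}
    (hξ : ContDiffOn ℝ (⊤ : ℕ∞) ξ U)
    (hk : ∀ x ∈ U, ∀ v w, fderiv ℝ (metB g) x (ξ x) v w + metB g x (fderiv ℝ ξ x v) w
      + metB g x v (fderiv ℝ ξ x w) = 0)
    {F E Y Z : ℝ → Pt 3} {t : ℝ} (hF : HasDerivAt F (ξ (F t)) t) (hFt : F t ∈ U)
    (hE : HasDerivAt E (fderiv ℝ ξ (F t) (E t)) t) (hY : HasDerivAt Y (fderiv ℝ ξ (F t) (Y t)) t)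
    (hZ : HasDerivAt Z (fderiv ℝ (fderiv ℝ ξ) (F t) (E t) (Y t) + fderiv ℝ ξ (F t) (Z t)) t)
    (u : Pt 3) :
    HasDerivAt (fun s => metB g (F s) (Z s + gam g (F s) (E s) (Y s)) u)
      (-metB g (F t) (Z t + gam g (F t) (E t) (Y t)) (fderiv ℝ ξ (F t) u)) t :=
  hasDerivAt_bilin_add_christoffel hU hg.contDiffOn_metB hg.metB_symm
    (fun _ hx v w u => hg.metB_gam hU hx v w u) hξ hk hF hFt hE hY hZ u

end Metric

section LinearODE

variable {E : Type} [NormedAddCommGroup E] [NormedSpace ℝ E]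

lemma eq_zero_of_ode_of_norm_sub_le {δ : ℝ} {K : NNReal} {P : ℝ → E} {B : ℝ → E → E}
    (hP : ∀ t ∈ Ioo (-δ) δ, HasDerivAt P (B t (P t)) t) (hB0 : ∀ t ∈ Ioo (-δ) δ, B t 0 = 0)
    (hB : ∀ t ∈ Ioo (-δ) δ, ∀ x y, ‖B t x - B t y‖ ≤ K * ‖x - y‖) (h0 : P 0 = 0) {t : ℝ}
    (ht : t ∈ Ioo (-δ) δ) : P t = 0 := by
  have h00 : (0 : ℝ) ∈ Ioo (-δ) δ := ⟨by linarith [ht.1, ht.2], by linarith [ht.1, ht.2]⟩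
  exact ODE_solution_unique_of_mem_Ioo (v := B) (s := fun _ => univ) (K := K)
    (f := P) (g := fun _ => 0)
    (fun t ht => LipschitzOnWith.of_dist_le_mul fun x _ y _ => by
      simpa [dist_eq_norm] using hB t ht x y)
    h00 (fun t ht => ⟨hP t ht, mem_univ _⟩)
    (fun t ht => ⟨by rw [hB0 t ht]; exact hasDerivAt_const t 0, mem_univ _⟩) h0 ht

variable [FiniteDimensional ℝ E]

lemma hasDerivAt_clm_of_apply {P : ℝ → E →L[ℝ] ℝ} {L : E →L[ℝ] ℝ} {t : ℝ}
    (h : ∀ u, HasDerivAt (fun s => P s u) (L u) t) : HasDerivAt P L t := by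
  let b := Module.finBasis ℝ E
  let c : Fin (Module.finrank ℝ E) → E →L[ℝ] ℝ := fun i =>
    LinearMap.toContinuousLinearMap (b.coord i)
  have hsum : ∀ M : E →L[ℝ] ℝ, M = ∑ i, M (b i) • c i := by
    intro M
    ext v
    have h := congrArg M (b.sum_repr v)
    rw [map_sum] at h
    simp [c, ← h, mul_comm]
  have hd : HasDerivAt (fun s => ∑ i, P s (b i) • c i) (∑ i, L (b i) • c i) t :=
    HasDerivAt.fun_sum fun i _ => (h (b i)).smul_const (c i)
  rw [hsum L]
  exact hd.congr_of_eventuallyEq (Filter.Eventually.of_forall fun s => hsum (P s))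

/-- A covector solving a linear transport equation vanishes if it vanishes initially. -/
lemma clm_eq_zero_of_linear_ode {δ : ℝ} {K : NNReal} {P : ℝ → E →L[ℝ] ℝ} {A : ℝ → E →L[ℝ] E}
    (hP : ∀ t ∈ Ioo (-δ) δ, ∀ u, HasDerivAt (fun s => P s u) (-P t (A t u)) t)
    (hA : ∀ t ∈ Ioo (-δ) δ, ‖A t‖ ≤ K) (h0 : P 0 = 0) {t : ℝ} (ht : t ∈ Ioo (-δ) δ) : P t = 0 := by
  have hPA : ∀ t ∈ Ioo (-δ) δ, HasDerivAt P (-(P t).comp (A t)) t := fun t ht =>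
    hasDerivAt_clm_of_apply fun u => hP t ht u
  refine eq_zero_of_ode_of_norm_sub_le (K := K) (B := fun t L => -L.comp (A t)) hPA
    (fun t _ => by simp) (fun t ht L M => ?_) h0 ht
  rw [neg_sub_neg, ← ContinuousLinearMap.sub_comp, ← norm_neg (L - M), neg_sub, mul_comm]
  exact (ContinuousLinearMap.opNorm_comp_le _ _).trans (by gcongr; exact hA t ht)

end LinearODE

section Bridge

variable {U : Set (Pt 3)} {g : Met 3} {x : Pt 3}

lemma covD_eq_cov {Y : Pt 3 → Pt 3} (hY : DifferentiableAt ℝ Y x) (v : Pt 3) :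
    covD g Y x v = fderiv ℝ Y x v + gam g x v (Y x) := by
  ext k
  rw [Pi.add_apply, gam, covD, fderiv_apply hY k]
  rfl

lemma covAlong_eq_cov {F W : Pt 2 → Pt 3} {u : Pt 2} (hW : DifferentiableAt ℝ W u) (v : Pt 2) :
    covAlong g F W u v = cov g F W u v := by
  ext k
  rw [cov, Pi.add_apply, gam, covAlong, fderiv_apply hW k]
  rfl

lemma vel_eq_deriv {γ : ℝ → Pt 3} {s : ℝ} (h : DifferentiableAt ℝ γ s) : vel γ s = deriv γ s := by
  rw [deriv_pi (differentiableAt_pi.1 h)]; rfl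

lemma curveAccel_eq {γ : ℝ → Pt 3} {s : ℝ} (h : ContDiffAt ℝ 2 γ s) :
    curveAccel g γ s = deriv (deriv γ) s + gam g (γ s) (deriv γ s) (deriv γ s) := by
  have h1 : ∀ᶠ t in nhds s, DifferentiableAt ℝ γ t :=
    (h.eventually (by simp)).mono fun t ht => ht.differentiableAt (by simp)
  have h2 : DifferentiableAt ℝ (deriv γ) s :=
    ((h.fderiv_right (m := 1) (by norm_num)).differentiableAt one_ne_zero).clm_apply
      (differentiableAt_const (1 : ℝ))
  have hd : ∀ k, ∀ t, DifferentiableAt ℝ γ t → deriv (fun r => γ r k) t = deriv γ t k :=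
    fun k t ht => by rw [deriv_pi (differentiableAt_pi.1 ht)]
  ext k
  rw [Pi.add_apply, gam, curveAccel]
  simp only [hd _ s h1.self_of_nhds]
  rw [Filter.EventuallyEq.deriv_eq (f := fun t => deriv γ t k) (h1.mono fun t ht => hd k t ht),
    deriv_pi (differentiableAt_pi.1 h2)]

lemma crossG_self (g : Met 3) (x v : Pt 3) : crossG g x v v = 0 := by
  ext k
  simp [crossG, lcSymb, Fin.sum_univ_three]
  exact Or.inr (by ring)

lemma IsMetricOn.det_pos (hg : IsMetricOn U g) (hx : x ∈ U) : 0 < (Matrix.of (g x)).det := by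
  refine Matrix.PosDef.det_pos (Matrix.PosDef.of_dotProduct_mulVec_pos ?_ ?_)
  · ext i j; simp [hg.2.1 x i j]
  · intro v hv
    have h : star v ⬝ᵥ (Matrix.of (g x)).mulVec v = minner g x v v := by
      simp [minner, dotProduct, Matrix.mulVec, Fin.sum_univ_three]
      ring
    rw [h]
    exact hg.2.2 x hx v hv

lemma IsMetricOn.eq_zero_of_crossG (hg : IsMetricOn U g) (hx : x ∈ U) {v w : Pt 3} (hw : w ≠ 0)
    (hvw : metB g x v w = 0) (hc : crossG g x v w = 0) : v = 0 := by
  let b : Pt 3 := fun l => ∑ i, ∑ j, lcSymb l i j * v i * w j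
  have hb : b = 0 := by
    ext m
    rw [← hg.sum_mul_ginv hx b m]
    refine Finset.sum_eq_zero fun k _ => mul_eq_zero_of_right _ ?_
    exact (mul_eq_zero.1 (congrFun hc k)).resolve_left (Real.sqrt_pos.2 (hg.det_pos hx)).ne'
  have h0 := congrFun hb 0
  have h1 := congrFun hb 1
  have h2 := congrFun hb 2
  simp [b, lcSymb, Fin.sum_univ_three] at h0 h1 h2
  obtain ⟨k, hk⟩ := Function.ne_iff.1 hw
  have hk : w k ≠ 0 := hk
  have hvk : v = (v k / w k) • w := by
    ext i
    rw [Pi.smul_apply, smul_eq_mul]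
    field_simp
    fin_cases i <;> fin_cases k <;> simp <;> linarith
  have : v k / w k = 0 := by
    rw [hvk, map_smul] at hvw
    exact (mul_eq_zero.1 (by simpa using hvw)).resolve_right (hg.metB_self_pos hx hw).ne'
  rw [hvk, this, zero_smul]

lemma IsMetricOn.linearIndependent_pair (hg : IsMetricOn U g) (hx : x ∈ U) {a b : Pt 3}
    (ha : a ≠ 0) (hb : b ≠ 0) (hab : metB g x a b = 0) : LinearIndependent ℝ ![a, b] := by
  rw [LinearIndependent.pair_iff]
  intro s t h
  have h1 := congrArg (fun z => metB g x z a) h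
  have h2 := congrArg (fun z => metB g x z b) h
  have hab' := hg.metB_symm x b a
  simp [hab, hab', (hg.metB_self_pos hx ha).ne', (hg.metB_self_pos hx hb).ne'] at h1 h2
  exact ⟨h1, h2⟩

/-- In dimension three, a vector orthogonal to two independent vectors and to their
common normal vanishes. -/
lemma IsMetricOn.eq_zero_of_orthogonal (hg : IsMetricOn U g) (hx : x ∈ U) {a b n X : Pt 3}
    (hab : LinearIndependent ℝ ![a, b]) (hn : n ≠ 0) (hna : metB g x n a = 0)
    (hnb : metB g x n b = 0) (hXa : metB g x X a = 0) (hXb : metB g x X b = 0)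
    (hXn : metB g x X n = 0) : X = 0 := by
  by_contra hX
  have hnn := (hg.metB_self_pos hx hn).ne'
  have hXX := (hg.metB_self_pos hx hX).ne'
  have hnX := hg.metB_symm x n X
  have hli : LinearIndependent ℝ ![a, b, n, X] := by
    rw [Fintype.linearIndependent_iff]
    intro c hc
    simp only [Fin.sum_univ_four, Matrix.cons_val] at hc
    have h1 := congrArg (metB g x n) hc
    have h2 := congrArg (metB g x X) hc
    simp [hna, hnb, hXa, hXb, hXn, hnX, hnn, hXX] at h1 h2
    rw [h1, h2] at hc
    have := LinearIndependent.pair_iff.1 hab (c 0) (c 1) (by simpa using hc)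
    intro i
    fin_cases i
    exacts [this.1, this.2, h1, h2]
  have := hli.fintype_card_le_finrank
  simp at this

end Bridge

section SurfaceToGeodesic

variable {U : Set (Pt 3)} {g : Met 3}

lemma IsMetricOn.contDiffOn_metB_comp (hg : IsMetricOn U g) {X : Type} [NormedAddCommGroup X]
    [NormedSpace ℝ X] {V : Set X} {F A B : X → Pt 3} (hF : ContDiffOn ℝ (⊤ : ℕ∞) F V)
    (hFU : ∀ u ∈ V, F u ∈ U) (hA : ContDiffOn ℝ (⊤ : ℕ∞) A V) (hB : ContDiffOn ℝ (⊤ : ℕ∞) B V) :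
    ContDiffOn ℝ (⊤ : ℕ∞) (fun u => metB g (F u) (A u) (B u)) V :=
  ((hg.contDiffOn_metB.comp hF hFU).clm_apply hA).clm_apply hB

lemma cov_add {X : Type} [NormedAddCommGroup X] [NormedSpace ℝ X] (F W : X → Pt 3) (u v v' : X) :
    cov g F W u (v + v') = cov g F W u v + cov g F W u v' := by
  simp only [cov, map_add, gam_add_left]
  abel

lemma cov_smul {X : Type} [NormedAddCommGroup X] [NormedSpace ℝ X] (F W : X → Pt 3) (u v : X)
    (c : ℝ) : cov g F W u (c • v) = c • cov g F W u v := by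
  simp only [cov, map_smul, gam_smul_left, smul_add]

lemma eq_sum_stdb_two (v : Pt 2) : v = v 0 • stdb 2 0 + v 1 • stdb 2 1 := by
  ext k
  fin_cases k <;> simp [stdb]

lemma cov_comp {X : Type} [NormedAddCommGroup X] [NormedSpace ℝ X] {F : X → Pt 3}
    {ξ : Pt 3 → Pt 3} {u : X} (hF : DifferentiableAt ℝ F u) (hξ : DifferentiableAt ℝ ξ (F u))
    (v : X) : cov g F (fun y => ξ (F y)) u v =
      fderiv ℝ ξ (F u) (fderiv ℝ F u v) + gam g (F u) (fderiv ℝ F u v) (ξ (F u)) := by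
  rw [cov, show (fun y => ξ (F y)) = ξ ∘ F from rfl, fderiv_comp u hξ hF]
  rfl

/-- On a totally geodesic surface tangent to a unit Killing field, the unit tangent field
orthogonal to the Killing field has geodesic integral curves, along which `τ` vanishes. -/
lemma IsMetricOn.exists_geodesic_of_surface (hg : IsMetricOn U g) (hU : IsOpen U)
    {ξ : Pt 3 → Pt 3} (hξ : ContDiffOn ℝ (⊤ : ℕ∞) ξ U)
    (hunit : ∀ x ∈ U, metB g x (ξ x) (ξ x) = 1)
    (hk : ∀ x ∈ U, ∀ v, metB g x (fderiv ℝ ξ x v + gam g x v (ξ x)) v = 0)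
    {τ : Pt 3 → ℝ} (hτ : ∀ x ∈ U, ∀ v, fderiv ℝ ξ x v + gam g x v (ξ x) = τ x • crossG g x v (ξ x))
    {V : Set (Pt 2)} {F N : Pt 2 → Pt 3} (hV : IsOpen V) (hF : ContDiffOn ℝ (⊤ : ℕ∞) F V)
    (hFU : ∀ u ∈ V, F u ∈ U)
    (hli : ∀ u ∈ V, LinearIndependent ℝ ![fderiv ℝ F u (stdb 2 0), fderiv ℝ F u (stdb 2 1)])
    (hN : ContDiffOn ℝ (⊤ : ℕ∞) N V) (hNN : ∀ u ∈ V, metB g (F u) (N u) (N u) = 1)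
    (hNF : ∀ u ∈ V, ∀ a, metB g (F u) (N u) (fderiv ℝ F u (stdb 2 a)) = 0)
    (hgeo : ∀ u ∈ V, ∀ a, cov g F N u (stdb 2 a) = 0)
    (htan : ∀ u ∈ V, metB g (F u) (ξ (F u)) (N u) = 0) {u₀ : Pt 2} (hu₀ : u₀ ∈ V) :
    ∃ (δ : ℝ) (γ : ℝ → Pt 3), 0 < δ ∧ γ 0 = F u₀ ∧ ContDiffOn ℝ (⊤ : ℕ∞) γ (Ioo (-δ) δ) ∧
      ∀ s ∈ Ioo (-δ) δ, γ s ∈ U ∧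
        deriv (deriv γ) s + gam g (γ s) (deriv γ s) (deriv γ s) = 0 ∧
        metB g (γ s) (deriv γ s) (deriv γ s) = 1 ∧ τ (γ s) = 0 ∧
        metB g (γ s) (deriv γ s) (ξ (γ s)) = 0 := by
  have hFd : ∀ u ∈ V, DifferentiableAt ℝ F u := fun u hu =>
    (hF.contDiffAt (hV.mem_nhds hu)).differentiableAt (by simp)
  have hNd : ∀ u ∈ V, DifferentiableAt ℝ N u := fun u hu =>
    (hN.contDiffAt (hV.mem_nhds hu)).differentiableAt (by simp)
  have hξd : ∀ x ∈ U, DifferentiableAt ℝ ξ x := fun x hx =>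
    (hξ.contDiffAt (hU.mem_nhds hx)).differentiableAt (by simp)
  have hξF : ContDiffOn ℝ (⊤ : ℕ∞) (fun u => ξ (F u)) V := hξ.comp hF hFU
  have hξFd : ∀ u ∈ V, DifferentiableAt ℝ (fun u => ξ (F u)) u := fun u hu =>
    (hξF.contDiffAt (hV.mem_nhds hu)).differentiableAt (by simp)
  have hdF : ContDiffOn ℝ (⊤ : ℕ∞) (fderiv ℝ F) V := hF.fderiv_of_isOpen hV (by simp)
  have hdFa : ∀ a, ContDiffOn ℝ (⊤ : ℕ∞) (fun u => fderiv ℝ F u (stdb 2 a)) V := fun a =>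
    hdF.clm_apply contDiffOn_const
  have hξ0 : ∀ u ∈ V, ξ (F u) ≠ 0 := fun u hu h => by
    have := hunit _ (hFU u hu)
    simp [h] at this
  have hN0 : ∀ u ∈ V, N u ≠ 0 := fun u hu h => by
    have := hNN u hu
    simp [h] at this
  have hev : ∀ {u} {p : Pt 2 → Prop}, u ∈ V → (∀ y ∈ V, p y) → ∀ᶠ y in nhds u, p y :=
    fun hu h => Filter.eventually_of_mem (hV.mem_nhds hu) h
  have hgeo' : ∀ u ∈ V, ∀ v, cov g F N u v = 0 := fun u hu v => by
    rw [eq_sum_stdb_two v, cov_add, cov_smul, cov_smul, hgeo u hu, hgeo u hu]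
    simp
  have hNF' : ∀ u ∈ V, ∀ v, metB g (F u) (N u) (fderiv ℝ F u v) = 0 := fun u hu v => by
    rw [eq_sum_stdb_two v, map_add, map_smul, map_smul, map_add, map_smul, map_smul,
      hNF u hu, hNF u hu]
    simp
  let w : Fin 2 → Pt 2 → ℝ := fun a u => metB g (F u) (fderiv ℝ F u (stdb 2 a)) (ξ (F u))
  have hw : ∀ a, ContDiffOn ℝ (⊤ : ℕ∞) (w a) V := fun a =>
    hg.contDiffOn_metB_comp hF hFU (hdFa a) hξF
  let c : Pt 2 → Pt 2 := fun u => w 1 u • stdb 2 0 - w 0 u • stdb 2 1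
  have hc : ContDiffOn ℝ (⊤ : ℕ∞) c V :=
    ((hw 1).smul contDiffOn_const).sub ((hw 0).smul contDiffOn_const)
  let X : Pt 2 → Pt 3 := fun u => fderiv ℝ F u (c u)
  have hX : ContDiffOn ℝ (⊤ : ℕ∞) X V := hdF.clm_apply hc
  have hXξ : ∀ u ∈ V, metB g (F u) (X u) (ξ (F u)) = 0 := fun u _ => by
    simp only [X, c, map_sub, map_smul, sub_apply, smul_apply, smul_eq_mul]
    simp only [w]
    ring
  have hX0 : ∀ u ∈ V, X u ≠ 0 := by
    intro u hu h
    simp only [X, c, map_sub, map_smul] at h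
    have := LinearIndependent.pair_iff.1 (hli u hu) (w 1 u) (-w 0 u) (by
      rw [← h, neg_smul, sub_eq_add_neg])
    have h0 : w 0 u = 0 := neg_eq_zero.1 this.2
    refine hξ0 u hu (hg.eq_zero_of_orthogonal (hFU u hu) (hli u hu) (hN0 u hu) (hNF u hu 0)
      (hNF u hu 1) ?_ ?_ (htan u hu))
    · rw [hg.metB_symm]; exact h0
    · rw [hg.metB_symm]; exact this.1
  have hLI : ∀ u ∈ V, LinearIndependent ℝ ![X u, ξ (F u)] := fun u hu =>
    hg.linearIndependent_pair (hFU u hu) (hX0 u hu) (hξ0 u hu) (hXξ u hu)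
  have hNξ : ∀ u ∈ V, metB g (F u) (N u) (ξ (F u)) = 0 := fun u hu => by
    rw [hg.metB_symm, htan u hu]
  have hτ0 : ∀ u ∈ V, τ (F u) = 0 := by
    intro u hu
    have hY := cov_comp (g := g) (hFd u hu) (hξd _ (hFU u hu)) (c u)
    have h1 := hg.metB_cov_add_eq_zero hU (hFd u hu) (hξFd u hu) (hξFd u hu) (hFU u hu)
      (hev hu fun y hy => hunit _ (hFU y hy)) (c u)
    have h2 := hg.metB_cov_add_eq_zero hU (hFd u hu) (hξFd u hu) (hNd u hu) (hFU u hu)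
      (hev hu htan) (c u)
    have h3 := hk _ (hFU u hu) (X u)
    rw [hg.metB_symm _ (ξ (F u)), ← two_mul] at h1
    rw [hgeo' u hu, map_zero, add_zero] at h2
    rw [← hY] at h3
    have h0 := hg.eq_zero_of_orthogonal (hFU u hu) (hLI u hu) (hN0 u hu) (hNF' u hu _)
      (hNξ u hu) h3 (by linarith) h2
    rw [hY, hτ _ (hFU u hu)] at h0
    refine (smul_eq_zero.1 h0).resolve_right fun h => hX0 u hu ?_
    exact hg.eq_zero_of_crossG (hFU u hu) (hξ0 u hu) (hXξ u hu) h
  have hcovξ : ∀ u ∈ V, ∀ v, cov g F (fun y => ξ (F y)) u v = 0 := fun u hu v => by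
    rw [cov_comp (hFd u hu) (hξd _ (hFU u hu)), hτ _ (hFU u hu), hτ0 u hu, zero_smul]
  let q : Pt 2 → ℝ := fun u => metB g (F u) (X u) (X u)
  have hq : ∀ u ∈ V, 0 < q u := fun u hu => hg.metB_self_pos (hFU u hu) (hX0 u hu)
  let r : Pt 2 → ℝ := fun u => (√(q u))⁻¹
  have hr : ContDiffOn ℝ (⊤ : ℕ∞) r V :=
    ((hg.contDiffOn_metB_comp hF hFU hX hX).sqrt fun u hu => (hq u hu).ne').inv
      fun u hu => (Real.sqrt_pos.2 (hq u hu)).ne'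
  let e : Pt 2 → Pt 2 := fun u => r u • c u
  have he : ContDiffOn ℝ (⊤ : ℕ∞) e V := hr.smul hc
  let T : Pt 2 → Pt 3 := fun u => fderiv ℝ F u (e u)
  have hT : ContDiffOn ℝ (⊤ : ℕ∞) T V := hdF.clm_apply he
  have hTd : ∀ u ∈ V, DifferentiableAt ℝ T u := fun u hu =>
    (hT.contDiffAt (hV.mem_nhds hu)).differentiableAt (by simp)
  have hTX : ∀ u, T u = r u • X u := fun u => map_smul _ _ _
  have hTT : ∀ u ∈ V, metB g (F u) (T u) (T u) = 1 := by
    intro u hu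
    have h := Real.sq_sqrt (hq u hu).le
    have h' := (Real.sqrt_pos.2 (hq u hu)).ne'
    rw [hTX, map_smul, map_smul, smul_apply, smul_eq_mul, smul_eq_mul]
    change (√(q u))⁻¹ * ((√(q u))⁻¹ * q u) = 1
    field_simp
    exact h.symm
  have hTξ : ∀ u ∈ V, metB g (F u) (T u) (ξ (F u)) = 0 := fun u hu => by
    rw [hTX, map_smul, smul_apply, hXξ u hu, smul_zero]
  have hTN : ∀ u ∈ V, metB g (F u) (T u) (N u) = 0 := fun u hu => by
    rw [hg.metB_symm]; exact hNF' u hu _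
  have hcovT : ∀ u ∈ V, ∀ v, cov g F T u v = 0 := by
    intro u hu v
    have h1 := hg.metB_cov_add_eq_zero hU (hFd u hu) (hTd u hu) (hTd u hu) (hFU u hu)
      (hev hu hTT) v
    have h2 := hg.metB_cov_add_eq_zero hU (hFd u hu) (hTd u hu) (hξFd u hu) (hFU u hu)
      (hev hu hTξ) v
    have h3 := hg.metB_cov_add_eq_zero hU (hFd u hu) (hTd u hu) (hNd u hu) (hFU u hu)
      (hev hu hTN) v
    rw [hg.metB_symm _ (T u), ← two_mul] at h1
    rw [hcovξ u hu, map_zero, add_zero] at h2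
    rw [hgeo' u hu, map_zero, add_zero] at h3
    have hXc : metB g (F u) (cov g F T u v) (X u) = 0 := by
      have : r u ≠ 0 := inv_ne_zero (Real.sqrt_pos.2 (hq u hu)).ne'
      rw [hTX, map_smul, smul_eq_mul] at h1
      simpa [this] using h1
    exact hg.eq_zero_of_orthogonal (hFU u hu) (hLI u hu) (hN0 u hu) (hNF' u hu _)
      (hNξ u hu) hXc h2 h3
  obtain ⟨δ, φ, hδ, hφ, hφ0, hflow⟩ := exists_smooth_local_flow hV he hu₀
  have hu₀δ : u₀ ∈ Metric.ball u₀ δ := Metric.mem_ball_self hδ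
  let α : ℝ → Pt 2 := fun t => φ (t, u₀)
  have hα : ContDiffOn ℝ (⊤ : ℕ∞) α (Ioo (-δ) δ) :=
    hφ.comp (contDiff_id.prodMk contDiff_const).contDiffOn fun t ht => ⟨ht, hu₀δ⟩
  have hαV : ∀ t ∈ Ioo (-δ) δ, α t ∈ V := fun t ht => (hflow t ht u₀ hu₀δ).1
  have hαd : ∀ t ∈ Ioo (-δ) δ, HasDerivAt α (e (α t)) t := fun t ht => (hflow t ht u₀ hu₀δ).2
  have hγd : ∀ t ∈ Ioo (-δ) δ, HasDerivAt (fun t => F (α t)) (T (α t)) t := fun t ht =>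
    (hFd _ (hαV t ht)).hasFDerivAt.comp_hasDerivAt t (hαd t ht)
  refine ⟨δ, fun t => F (α t), hδ, by simp only [α, hφ0], hF.comp hα hαV, fun s hs => ?_⟩
  have hs' := hαV s hs
  have hdd : deriv (deriv fun t => F (α t)) s = fderiv ℝ T (α s) (e (α s)) := by
    have : deriv (fun t => F (α t)) =ᶠ[nhds s] fun t => T (α t) :=
      Filter.eventually_of_mem (isOpen_Ioo.mem_nhds hs) fun t ht => (hγd t ht).deriv
    rw [this.deriv_eq]
    exact ((hTd _ hs').hasFDerivAt.comp_hasDerivAt s (hαd s hs)).deriv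
  rw [hdd, (hγd s hs).deriv]
  exact ⟨hFU _ hs', hcovT _ hs' _, hTT _ hs', hτ0 _ hs', hTξ _ hs'⟩

end SurfaceToGeodesic

section GeodesicToSurface

variable {U : Set (Pt 3)} {g : Met 3}

lemma IsMetricOn.eq_zero_of_metB_eq_zero (hg : IsMetricOn U g) {x : Pt 3} (hx : x ∈ U)
    {v : Pt 3} (h : metB g x v = 0) : v = 0 :=
  hg.eq_zero_of_metB_self hx (by rw [h]; rfl)

lemma IsMetricOn.gam_symm (hg : IsMetricOn U g) (hU : IsOpen U) {x : Pt 3} (hx : x ∈ U)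
    (v w : Pt 3) : gam g x v w = gam g x w v := by
  refine sub_eq_zero.1 (hg.eq_zero_of_metB_eq_zero hx (ContinuousLinearMap.ext fun u => ?_))
  rw [map_sub, sub_apply, hg.metB_gam hU hx, hg.metB_gam hU hx, hg.fderiv_metB_symm hU hx _ w v,
    zero_apply]
  ring

/-- Mixed second derivatives commute, expressed through a known first derivative. -/
lemma fderiv_fderiv_apply_comm {X Y : Type} [NormedAddCommGroup X] [NormedSpace ℝ X]
    [NormedAddCommGroup Y] [NormedSpace ℝ Y] {V : Set X} (hV : IsOpen V) {W R : X → Y}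
    (hW : ContDiffOn ℝ (⊤ : ℕ∞) W V) {a b : X} (hR : ∀ y ∈ V, fderiv ℝ W y b = R y) {u : X}
    (hu : u ∈ V) : fderiv ℝ (fun y => fderiv ℝ W y a) u b = fderiv ℝ R u a := by
  have hWu := hW.contDiffAt (hV.mem_nhds hu)
  have hd : DifferentiableAt ℝ (fderiv ℝ W) u :=
    (hWu.fderiv_right (m := 1) (by norm_cast)).differentiableAt one_ne_zero
  have hsymm := hWu.isSymmSndFDerivAt (by simp; exact WithTop.coe_le_coe.2 le_top)
  have hR' : (fun y => fderiv ℝ W y b) =ᶠ[nhds u] R :=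
    Filter.eventually_of_mem (hV.mem_nhds hu) hR
  rw [← hR'.fderiv_eq, fderiv_clm_apply hd (differentiableAt_const _),
    fderiv_clm_apply hd (differentiableAt_const _)]
  simpa using hsymm.eq b a

/-- The coordinate line of `Pt 2` in direction `1`. -/
lemma hasDerivAt_cons_right (s t : ℝ) : HasDerivAt (fun t => (![s, t] : Pt 2)) (stdb 2 1) t := by
  rw [hasDerivAt_pi]
  intro i
  fin_cases i
  · simpa [stdb] using hasDerivAt_const t s
  · simpa [stdb] using hasDerivAt_id' t

lemma hasDerivAt_cons_left (s t : ℝ) : HasDerivAt (fun s => (![s, t] : Pt 2)) (stdb 2 0) s := by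
  rw [hasDerivAt_pi]
  intro i
  fin_cases i
  · simpa [stdb] using hasDerivAt_id' s
  · simpa [stdb] using hasDerivAt_const s t

/-- Two coordinate directions determine the covariant derivative. -/
lemma cov_eq_zero_of_stdb {F W : Pt 2 → Pt 3} {u : Pt 2} (h0 : cov g F W u (stdb 2 0) = 0)
    (h1 : cov g F W u (stdb 2 1) = 0) (v : Pt 2) : cov g F W u v = 0 := by
  rw [eq_sum_stdb_two v, cov_add, cov_smul, cov_smul, h0, h1]
  simp

/-- The flow-out of a geodesic under a Killing field `ξ` which is parallel along the geodesic:
the coordinate field along the geodesics and the Killing field are parallel along the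
resulting surface. -/
lemma IsMetricOn.cov_flow_out (hg : IsMetricOn U g) (hU : IsOpen U)
    {ξ : Pt 3 → Pt 3} (hξ : ContDiffOn ℝ (⊤ : ℕ∞) ξ U)
    (hk : ∀ x ∈ U, ∀ v w, metB g x (fderiv ℝ ξ x v + gam g x v (ξ x)) w
      + metB g x (fderiv ℝ ξ x w + gam g x w (ξ x)) v = 0)
    (hξξ : ∀ x ∈ U, fderiv ℝ ξ x (ξ x) + gam g x (ξ x) (ξ x) = 0)
    {K : NNReal} {η s₀ : ℝ} {F : Pt 2 → Pt 3} {γ : ℝ → Pt 3}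
    (hF : ContDiffOn ℝ (⊤ : ℕ∞) F (Metric.ball ![s₀, 0] η))
    (hFU : ∀ u ∈ Metric.ball ![s₀, 0] η, F u ∈ U)
    (hFK : ∀ u ∈ Metric.ball ![s₀, 0] η, ‖fderiv ℝ ξ (F u)‖ ≤ K)
    (hFt : ∀ u ∈ Metric.ball ![s₀, 0] η, fderiv ℝ F u (stdb 2 1) = ξ (F u))
    (hFγ : ∀ s, F ![s, 0] = γ s)
    (hγ : ∀ s ∈ Metric.ball s₀ η,
      deriv (deriv γ) s + gam g (γ s) (deriv γ s) (deriv γ s) = 0)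
    (hγξ : ∀ s ∈ Metric.ball s₀ η,
      fderiv ℝ ξ (γ s) (deriv γ s) + gam g (γ s) (deriv γ s) (ξ (γ s)) = 0) :
    (∀ u ∈ Metric.ball ![s₀, 0] η, ∀ v, cov g F (fun y => fderiv ℝ F y (stdb 2 0)) u v = 0) ∧
    (∀ u ∈ Metric.ball ![s₀, 0] η, ∀ v, cov g F (fun y => ξ (F y)) u v = 0) := by
  set V : Set (Pt 2) := Metric.ball ![s₀, 0] η with hVdef
  have hV : IsOpen V := Metric.isOpen_ball
  have hVmem : ∀ s ∈ Metric.ball s₀ η, ∀ t ∈ Ioo (-η) η, (![s, t] : Pt 2) ∈ V := by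
    intro s hs t ht
    have hη : 0 < η := by linarith [ht.1, ht.2]
    rw [hVdef, Metric.mem_ball, dist_pi_lt_iff hη]
    intro i
    fin_cases i
    · exact hs
    · simpa [Real.dist_eq, abs_lt] using ht
  have hVmem' : ∀ u ∈ V, u 0 ∈ Metric.ball s₀ η ∧ u 1 ∈ Ioo (-η) η := by
    intro u hu
    have hη : 0 < η := Metric.pos_of_mem_ball hu
    rw [hVdef, Metric.mem_ball, dist_pi_lt_iff hη] at hu
    refine ⟨hu 0, ?_⟩
    simpa [Real.dist_eq, abs_lt] using hu 1
  have hd : ∀ {W : Pt 2 → Pt 3}, ContDiffOn ℝ (⊤ : ℕ∞) W V → ∀ u ∈ V, DifferentiableAt ℝ W u :=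
    fun hW u hu => (hW.contDiffAt (hV.mem_nhds hu)).differentiableAt (by simp)
  have hFd := hd hF
  have hξd : ∀ x ∈ U, DifferentiableAt ℝ ξ x := fun x hx =>
    (hξ.contDiffAt (hU.mem_nhds hx)).differentiableAt (by simp)
  have hDξ : ContDiffOn ℝ (⊤ : ℕ∞) (fderiv ℝ ξ) U := hξ.fderiv_of_isOpen hU (by simp)
  have hDξd : ∀ x ∈ U, DifferentiableAt ℝ (fderiv ℝ ξ) x := fun x hx =>
    (hDξ.contDiffAt (hU.mem_nhds hx)).differentiableAt (by simp)
  have hξsymm : ∀ x ∈ U, ∀ a b, fderiv ℝ (fderiv ℝ ξ) x a b = fderiv ℝ (fderiv ℝ ξ) x b a :=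
    fun x hx => ((hξ.contDiffAt (hU.mem_nhds hx)).isSymmSndFDerivAt
      (by simp; exact WithTop.coe_le_coe.2 le_top)).eq
  let E : Pt 2 → Pt 3 := fun y => fderiv ℝ F y (stdb 2 0)
  have hE : ContDiffOn ℝ (⊤ : ℕ∞) E V :=
    (hF.fderiv_of_isOpen hV (by simp)).clm_apply contDiffOn_const
  have hEd := hd hE
  let Z : Pt 2 → Pt 3 := fun y => fderiv ℝ E y (stdb 2 0)
  have hZ : ContDiffOn ℝ (⊤ : ℕ∞) Z V :=
    (hE.fderiv_of_isOpen hV (by simp)).clm_apply contDiffOn_const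
  have hZd := hd hZ
  have hξFd : ∀ u ∈ V, HasFDerivAt (fun y => ξ (F y))
      ((fderiv ℝ ξ (F u)).comp (fderiv ℝ F u)) u := fun u hu =>
    (hξd _ (hFU u hu)).hasFDerivAt.comp u (hFd u hu).hasFDerivAt
  have hDξFd : ∀ u ∈ V, HasFDerivAt (fun y => fderiv ℝ ξ (F y))
      ((fderiv ℝ (fderiv ℝ ξ) (F u)).comp (fderiv ℝ F u)) u := fun u hu =>
    HasFDerivAt.comp (g := fderiv ℝ ξ) u (hDξd _ (hFU u hu)).hasFDerivAt (hFd u hu).hasFDerivAt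
  have hEt : ∀ u ∈ V, fderiv ℝ E u (stdb 2 1) = fderiv ℝ ξ (F u) (E u) := fun u hu => by
    rw [fderiv_fderiv_apply_comm hV hF hFt hu, (hξFd u hu).fderiv]
    rfl
  have hDE : ∀ u ∈ V, ∀ v, fderiv ℝ (fun y => fderiv ℝ ξ (F y) (E y)) u v =
      fderiv ℝ (fderiv ℝ ξ) (F u) (fderiv ℝ F u v) (E u) + fderiv ℝ ξ (F u) (fderiv ℝ E u v) :=
    fun u hu v => by
      rw [((hDξFd u hu).clm_apply (hEd u hu).hasFDerivAt).fderiv]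
      simp [add_comm]
  have hZt : ∀ u ∈ V, fderiv ℝ Z u (stdb 2 1) =
      fderiv ℝ (fderiv ℝ ξ) (F u) (E u) (E u) + fderiv ℝ ξ (F u) (Z u) := fun u hu => by
    rw [fderiv_fderiv_apply_comm hV hE hEt hu, hDE u hu]
  have hkill : ∀ x ∈ U, ∀ v w, fderiv ℝ (metB g) x (ξ x) v w + metB g x (fderiv ℝ ξ x v) w
      + metB g x v (fderiv ℝ ξ x w) = 0 := fun x hx v w =>
    hg.fderiv_metB_killing hU hk hx v w
  have hline : ∀ {W : Pt 2 → Pt 3} {s t : ℝ}, DifferentiableAt ℝ W ![s, t] →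
      HasDerivAt (fun t => W ![s, t]) (fderiv ℝ W ![s, t] (stdb 2 1)) t := fun {W s t} hW =>
    HasFDerivAt.comp_hasDerivAt (f := fun t => (![s, t] : Pt 2)) t hW.hasFDerivAt
      (hasDerivAt_cons_right s t)
  have hline' : ∀ {W : Pt 2 → Pt 3} {s t : ℝ}, DifferentiableAt ℝ W ![s, t] →
      HasDerivAt (fun s => W ![s, t]) (fderiv ℝ W ![s, t] (stdb 2 0)) s := fun {W s t} hW =>
    HasFDerivAt.comp_hasDerivAt (f := fun s => (![s, t] : Pt 2)) s hW.hasFDerivAt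
      (hasDerivAt_cons_left s t)
  have htransport : ∀ Y Z' : Pt 2 → Pt 3, (∀ u ∈ V, DifferentiableAt ℝ Y u) →
      (∀ u ∈ V, DifferentiableAt ℝ Z' u) →
      (∀ u ∈ V, fderiv ℝ Y u (stdb 2 1) = fderiv ℝ ξ (F u) (Y u)) →
      (∀ u ∈ V, fderiv ℝ Z' u (stdb 2 1) =
        fderiv ℝ (fderiv ℝ ξ) (F u) (E u) (Y u) + fderiv ℝ ξ (F u) (Z' u)) →
      (∀ s ∈ Metric.ball s₀ η,
        Z' ![s, 0] + gam g (F ![s, 0]) (E ![s, 0]) (Y ![s, 0]) = 0) →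
      ∀ u ∈ V, Z' u + gam g (F u) (E u) (Y u) = 0 := by
    intro Y Z' hYd hZ'd hYt hZ't h0 u hu
    obtain ⟨hs, ht⟩ := hVmem' u hu
    have hu2 : u = ![u 0, u 1] := by
      ext i; fin_cases i <;> rfl
    refine hg.eq_zero_of_metB_eq_zero (hFU u hu) ?_
    rw [hu2]
    refine clm_eq_zero_of_linear_ode (K := K) (δ := η) (P := fun t => metB g (F ![u 0, t])
      (Z' ![u 0, t] + gam g (F ![u 0, t]) (E ![u 0, t]) (Y ![u 0, t])))
      (A := fun t => fderiv ℝ ξ (F ![u 0, t])) (fun t ht v => ?_)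
      (fun t ht => hFK _ (hVmem _ hs t ht)) (by simp only [h0 _ hs, map_zero]) ht
    have hm := hVmem _ hs t ht
    refine hg.hasDerivAt_metB_add_gam hU hξ hkill (F := fun t => F ![u 0, t])
      (E := fun t => E ![u 0, t]) (Y := fun t => Y ![u 0, t]) (Z := fun t => Z' ![u 0, t])
      ?_ (hFU _ hm) ?_ ?_ ?_ v
    · rw [← hFt _ hm]; exact hline (hFd _ hm)
    · rw [← hEt _ hm]; exact hline (hEd _ hm)
    · rw [← hYt _ hm]; exact hline (hYd _ hm)
    · rw [← hZ't _ hm]; exact hline (hZ'd _ hm)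
  have hE0 : ∀ s ∈ Metric.ball s₀ η, E ![s, 0] = deriv γ s := fun s hs => by
    have hη := Metric.pos_of_mem_ball hs
    have := hline' (hFd _ (hVmem s hs 0 ⟨by linarith, hη⟩))
    simp only [hFγ] at this
    exact this.deriv.symm
  have hZ0 : ∀ s ∈ Metric.ball s₀ η, Z ![s, 0] = deriv (deriv γ) s := fun s hs => by
    have hη := Metric.pos_of_mem_ball hs
    have h1 := hline' (hEd _ (hVmem s hs 0 ⟨by linarith, hη⟩))
    have h2 : (fun s => E ![s, 0]) =ᶠ[nhds s] deriv γ :=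
      Filter.eventually_of_mem (Metric.isOpen_ball.mem_nhds hs) hE0
    rw [← h2.deriv_eq]
    exact h1.deriv.symm
  have hcovE := htransport E Z hEd hZd hEt hZt fun s hs => by
    rw [hE0 s hs, hZ0 s hs, hFγ, hγ s hs]
  have hcovξ := htransport (fun u => ξ (F u)) (fun u => fderiv ℝ ξ (F u) (E u))
    (fun u hu => (hξFd u hu).differentiableAt)
    (fun u hu => (hDξFd u hu).differentiableAt.clm_apply (hEd u hu))
    (fun u hu => by rw [(hξFd u hu).fderiv, ContinuousLinearMap.comp_apply, hFt u hu])
    (fun u hu => by rw [hDE u hu, hFt u hu, hEt u hu, hξsymm _ (hFU u hu)])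
    (fun s hs => by rw [hE0 s hs, hFγ, hγξ s hs])
  refine ⟨fun u hu => cov_eq_zero_of_stdb (hcovE u hu) ?_,
    fun u hu => cov_eq_zero_of_stdb ?_ ?_⟩
  · change fderiv ℝ E u (stdb 2 1) + gam g (F u) (fderiv ℝ F u (stdb 2 1)) (E u) = 0
    rw [hEt u hu, hFt u hu, hg.gam_symm hU (hFU u hu)]
    exact hcovξ u hu
  · rw [cov_comp (hFd u hu) (hξd _ (hFU u hu))]
    exact hcovξ u hu
  · rw [cov_comp (hFd u hu) (hξd _ (hFU u hu)), hFt u hu]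
    exact hξξ _ (hFU u hu)

end GeodesicToSurface

section Surface

variable {U : Set (Pt 3)} {g : Met 3}

/-- A nonzero vector orthogonal to two given ones. -/
lemma exists_ne_zero_metB_eq_zero (g : Met 3) (x a b : Pt 3) :
    ∃ w : Pt 3, w ≠ 0 ∧ metB g x w a = 0 ∧ metB g x w b = 0 := by
  let L : Pt 3 →ₗ[ℝ] Pt 2 :=
    LinearMap.pi ![((metB g x).flip a : Pt 3 →ₗ[ℝ] ℝ), ((metB g x).flip b : Pt 3 →ₗ[ℝ] ℝ)]
  have hL : LinearMap.ker L ≠ ⊥ := LinearMap.ker_ne_bot_of_finrank_lt (by simp)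
  obtain ⟨w, hw, hw0⟩ := Submodule.exists_mem_ne_zero_of_ne_bot hL
  have h := LinearMap.mem_ker.1 hw
  exact ⟨w, hw0, by simpa [L] using congrFun h 0, by simpa [L] using congrFun h 1⟩

/-- The function `⟨A, B⟩` is constant if `A` and `B` are parallel along a map. -/
lemma IsMetricOn.metB_eq_of_parallel (hg : IsMetricOn U g) (hU : IsOpen U)
    {V : Set (Pt 2)} (hV : IsOpen V) (hV' : IsPreconnected V) {F A B : Pt 2 → Pt 3}
    (hF : ContDiffOn ℝ (⊤ : ℕ∞) F V) (hFU : ∀ u ∈ V, F u ∈ U) (hA : ContDiffOn ℝ (⊤ : ℕ∞) A V)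
    (hB : ContDiffOn ℝ (⊤ : ℕ∞) B V) (hcA : ∀ u ∈ V, ∀ v, cov g F A u v = 0)
    (hcB : ∀ u ∈ V, ∀ v, cov g F B u v = 0) {u₀ u : Pt 2} (hu₀ : u₀ ∈ V) (hu : u ∈ V) :
    metB g (F u) (A u) (B u) = metB g (F u₀) (A u₀) (B u₀) := by
  have hd : ∀ {W : Pt 2 → Pt 3}, ContDiffOn ℝ (⊤ : ℕ∞) W V → ∀ u ∈ V, DifferentiableAt ℝ W u :=
    fun hW u hu => (hW.contDiffAt (hV.mem_nhds hu)).differentiableAt (by simp)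
  refine hV.is_const_of_fderiv_eq_zero (𝕜 := ℝ) (f := fun u => metB g (F u) (A u) (B u)) hV'
    ((hg.contDiffOn_metB_comp hF hFU hA hB).differentiableOn (by simp)) (fun y hy => ?_) hu hu₀
  ext v
  rw [hg.fderiv_metB_comp hU (hd hF y hy) (hd hA y hy) (hd hB y hy) (hFU y hy), hcA y hy,
    hcB y hy]
  simp

/-- Completing an orthonormal parallel tangent frame by a parallel unit normal. -/
lemma IsMetricOn.exists_parallel_normal (hg : IsMetricOn U g) (hU : IsOpen U)
    {V₀ : Set (Pt 2)} (hV₀ : IsOpen V₀) {F A B : Pt 2 → Pt 3}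
    (hF : ContDiffOn ℝ (⊤ : ℕ∞) F V₀) (hFU : ∀ u ∈ V₀, F u ∈ U)
    (hA : ContDiffOn ℝ (⊤ : ℕ∞) A V₀) (hB : ContDiffOn ℝ (⊤ : ℕ∞) B V₀)
    (hcA : ∀ u ∈ V₀, ∀ v, cov g F A u v = 0) (hcB : ∀ u ∈ V₀, ∀ v, cov g F B u v = 0)
    (hAA : ∀ u ∈ V₀, metB g (F u) (A u) (A u) = 1) (hBB : ∀ u ∈ V₀, metB g (F u) (B u) (B u) = 1)
    (hAB : ∀ u ∈ V₀, metB g (F u) (A u) (B u) = 0) {u₀ : Pt 2} (hu₀ : u₀ ∈ V₀) :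
    ∃ (V : Set (Pt 2)) (N : Pt 2 → Pt 3), IsOpen V ∧ V ⊆ V₀ ∧ u₀ ∈ V ∧
      ContDiffOn ℝ (⊤ : ℕ∞) N V ∧ ∀ u ∈ V, metB g (F u) (N u) (N u) = 1 ∧
        metB g (F u) (N u) (A u) = 0 ∧ metB g (F u) (N u) (B u) = 0 ∧
        ∀ v, cov g F N u v = 0 := by
  obtain ⟨w, hw0, hwA, hwB⟩ := exists_ne_zero_metB_eq_zero g (F u₀) (A u₀) (B u₀)
  let n : Pt 2 → Pt 3 := fun u =>
    w - metB g (F u) w (A u) • A u - metB g (F u) w (B u) • B u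
  have hn : ContDiffOn ℝ (⊤ : ℕ∞) n V₀ :=
    (contDiffOn_const.sub ((hg.contDiffOn_metB_comp hF hFU contDiffOn_const hA).smul hA)).sub
      ((hg.contDiffOn_metB_comp hF hFU contDiffOn_const hB).smul hB)
  let ν : Pt 2 → ℝ := fun u => metB g (F u) (n u) (n u)
  have hν : ContDiffOn ℝ (⊤ : ℕ∞) ν V₀ := hg.contDiffOn_metB_comp hF hFU hn hn
  have hnA : ∀ u ∈ V₀, metB g (F u) (n u) (A u) = 0 := fun u hu => by
    simp only [n, map_sub, map_smul, sub_apply, smul_apply, smul_eq_mul]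
    rw [hAA u hu, hg.metB_symm _ (B u), hAB u hu]
    ring
  have hnB : ∀ u ∈ V₀, metB g (F u) (n u) (B u) = 0 := fun u hu => by
    simp only [n, map_sub, map_smul, sub_apply, smul_apply, smul_eq_mul]
    rw [hBB u hu, hAB u hu]
    ring
  let V : Set (Pt 2) := V₀ ∩ ν ⁻¹' Ioi 0
  have hV : IsOpen V := hν.continuousOn.isOpen_inter_preimage hV₀ isOpen_Ioi
  have hVsub : V ⊆ V₀ := inter_subset_left
  have hνpos : ∀ u ∈ V, 0 < ν u := fun u hu => hu.2
  let N : Pt 2 → Pt 3 := fun u => (√(ν u))⁻¹ • n u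
  have hN : ContDiffOn ℝ (⊤ : ℕ∞) N V :=
    (((hν.mono hVsub).sqrt fun u hu => (hνpos u hu).ne').inv
      fun u hu => (Real.sqrt_pos.2 (hνpos u hu)).ne').smul (hn.mono hVsub)
  have hNN : ∀ u ∈ V, metB g (F u) (N u) (N u) = 1 := by
    intro u hu
    have h := Real.sq_sqrt (hνpos u hu).le
    have h' := (Real.sqrt_pos.2 (hνpos u hu)).ne'
    simp only [N, map_smul, smul_apply, smul_eq_mul]
    change (√(ν u))⁻¹ * ((√(ν u))⁻¹ * ν u) = 1
    field_simp
    exact h.symm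
  have hNA : ∀ u ∈ V, metB g (F u) (N u) (A u) = 0 := fun u hu => by
    simp only [N, map_smul, smul_apply, hnA u (hVsub hu), smul_zero]
  have hNB : ∀ u ∈ V, metB g (F u) (N u) (B u) = 0 := fun u hu => by
    simp only [N, map_smul, smul_apply, hnB u (hVsub hu), smul_zero]
  have hne : ∀ {u : Pt 2} {W : Pt 3}, metB g (F u) W W = 1 → W ≠ 0 := by
    rintro u W h rfl
    simp at h
  have hd : ∀ {W : Pt 2 → Pt 3}, ContDiffOn ℝ (⊤ : ℕ∞) W V → ∀ u ∈ V, DifferentiableAt ℝ W u :=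
    fun hW u hu => (hW.contDiffAt (hV.mem_nhds hu)).differentiableAt (by simp)
  have hev : ∀ {u} {p : Pt 2 → Prop}, u ∈ V → (∀ y ∈ V, p y) → ∀ᶠ y in nhds u, p y :=
    fun hu h => Filter.eventually_of_mem (hV.mem_nhds hu) h
  refine ⟨V, N, hV, hVsub, ⟨hu₀, ?_⟩, hN, fun u hu => ⟨hNN u hu, hNA u hu, hNB u hu, fun v => ?_⟩⟩
  · refine hg.metB_self_pos (hFU u₀ hu₀) ?_
    simpa [n, hwA, hwB] using hw0
  · have hFu := hFU u (hVsub hu)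
    have hFd := hd (hF.mono hVsub) u hu
    have hNd := hd hN u hu
    have h1 := hg.metB_cov_add_eq_zero hU hFd hNd hNd hFu (hev hu hNN) v
    have h2 := hg.metB_cov_add_eq_zero hU hFd hNd (hd (hA.mono hVsub) u hu) hFu (hev hu hNA) v
    have h3 := hg.metB_cov_add_eq_zero hU hFd hNd (hd (hB.mono hVsub) u hu) hFu (hev hu hNB) v
    rw [hg.metB_symm _ (N u), ← two_mul] at h1
    rw [hcA u (hVsub hu), map_zero, add_zero] at h2
    rw [hcB u (hVsub hu), map_zero, add_zero] at h3
    exact hg.eq_zero_of_orthogonal hFu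
      (hg.linearIndependent_pair hFu (hne (hAA u (hVsub hu))) (hne (hBB u (hVsub hu)))
        (hAB u (hVsub hu)))
      (hne (hNN u hu)) (hNA u hu) (hNB u hu) h2 h3 (by linarith)

/-- Flowing out a geodesic along which a unit Killing field is parallel gives a totally
geodesic surface. -/
lemma IsMetricOn.exists_surface_of_geodesic (hg : IsMetricOn U g) (hU : IsOpen U)
    {ξ : Pt 3 → Pt 3} (hξ : ContDiffOn ℝ (⊤ : ℕ∞) ξ U)
    (hunit : ∀ x ∈ U, metB g x (ξ x) (ξ x) = 1)
    (hk : ∀ x ∈ U, ∀ v w, metB g x (fderiv ℝ ξ x v + gam g x v (ξ x)) w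
      + metB g x (fderiv ℝ ξ x w + gam g x w (ξ x)) v = 0)
    (hξξ : ∀ x ∈ U, fderiv ℝ ξ x (ξ x) + gam g x (ξ x) (ξ x) = 0)
    {I : Set ℝ} (hI : IsOpen I) {s₀ : ℝ} (hs₀ : s₀ ∈ I) {γ : ℝ → Pt 3}
    (hγU : ∀ s ∈ I, γ s ∈ U) (hγ : ContDiffOn ℝ (⊤ : ℕ∞) γ I)
    (hgeo : ∀ s ∈ I, deriv (deriv γ) s + gam g (γ s) (deriv γ s) (deriv γ s) = 0)
    (hspeed : metB g (γ s₀) (deriv γ s₀) (deriv γ s₀) = 1)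
    (hγξ : ∀ s ∈ I, fderiv ℝ ξ (γ s) (deriv γ s) + gam g (γ s) (deriv γ s) (ξ (γ s)) = 0)
    (horth : metB g (γ s₀) (deriv γ s₀) (ξ (γ s₀)) = 0) :
    ∃ (V : Set (Pt 2)) (F N : Pt 2 → Pt 3) (u₀ : Pt 2), IsOpen V ∧ u₀ ∈ V ∧ F u₀ = γ s₀ ∧
      ContDiffOn ℝ (⊤ : ℕ∞) F V ∧ ContDiffOn ℝ (⊤ : ℕ∞) N V ∧ ∀ u ∈ V, F u ∈ U ∧
        LinearIndependent ℝ ![fderiv ℝ F u (stdb 2 0), fderiv ℝ F u (stdb 2 1)] ∧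
        metB g (F u) (N u) (N u) = 1 ∧
        (∀ a, metB g (F u) (N u) (fderiv ℝ F u (stdb 2 a)) = 0) ∧
        (∀ v, cov g F N u v = 0) ∧ metB g (F u) (ξ (F u)) (N u) = 0 := by
  let K : NNReal := ‖fderiv ℝ ξ (γ s₀)‖₊ + 1
  let U' : Set (Pt 3) := U ∩ (fun x => ‖fderiv ℝ ξ x‖) ⁻¹' Iio (K : ℝ)
  have hU' : IsOpen U' :=
    (hξ.fderiv_of_isOpen hU (m := (⊤ : ℕ∞)) (by simp)).continuousOn.norm.isOpen_inter_preimage hU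
      isOpen_Iio
  have hp : γ s₀ ∈ U' := ⟨hγU s₀ hs₀, by simp [K]⟩
  obtain ⟨δ, φ, hδ, hφ, hφ0, hflow⟩ :=
    exists_smooth_local_flow hU' (hξ.mono inter_subset_left) hp
  have hJ : IsOpen (I ∩ γ ⁻¹' Metric.ball (γ s₀) δ) :=
    hγ.continuousOn.isOpen_inter_preimage hI Metric.isOpen_ball
  obtain ⟨η', hη', hball⟩ := Metric.isOpen_iff.1 hJ s₀ ⟨hs₀, Metric.mem_ball_self hδ⟩
  let η := min η' δ
  have hη : 0 < η := lt_min hη' hδ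
  have hsub : ∀ s ∈ Metric.ball s₀ η, s ∈ I ∧ γ s ∈ Metric.ball (γ s₀) δ := fun s hs =>
    hball (Metric.ball_subset_ball (min_le_left _ _) hs)
  let V₀ : Set (Pt 2) := Metric.ball ![s₀, 0] η
  have hV₀ : IsOpen V₀ := Metric.isOpen_ball
  have hu₀ : (![s₀, 0] : Pt 2) ∈ V₀ := Metric.mem_ball_self hη
  have hmem : ∀ u ∈ V₀, u 0 ∈ Metric.ball s₀ η ∧ u 1 ∈ Ioo (-δ) δ := by
    intro u hu
    have hu := (dist_pi_lt_iff hη).1 (Metric.mem_ball.1 hu)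
    refine ⟨hu 0, ?_⟩
    have h1 : |u 1| < η := by simpa [Real.dist_eq] using hu 1
    exact abs_lt.1 (h1.trans_le (min_le_right _ _))
  let F : Pt 2 → Pt 3 := fun u => φ (u 1, γ (u 0))
  have hF : ContDiffOn ℝ (⊤ : ℕ∞) F V₀ := by
    have h0 : ContDiffOn ℝ (⊤ : ℕ∞) (fun u : Pt 2 => γ (u 0)) V₀ :=
      hγ.comp (contDiff_apply ℝ ℝ (0 : Fin 2)).contDiffOn fun u hu => (hsub _ (hmem u hu).1).1
    exact hφ.comp ((contDiff_apply ℝ ℝ (1 : Fin 2)).contDiffOn.prodMk h0)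
      fun u hu => ⟨(hmem u hu).2, (hsub _ (hmem u hu).1).2⟩
  have hFU' : ∀ u ∈ V₀, F u ∈ U' := fun u hu =>
    (hflow _ (hmem u hu).2 _ (hsub _ (hmem u hu).1).2).1
  have hFU : ∀ u ∈ V₀, F u ∈ U := fun u hu => (hFU' u hu).1
  have hFd : ∀ u ∈ V₀, DifferentiableAt ℝ F u := fun u hu =>
    (hF.contDiffAt (hV₀.mem_nhds hu)).differentiableAt (by simp)
  have hcons : ∀ u : Pt 2, u = ![u 0, u 1] := fun u => by
    ext i; fin_cases i <;> rfl
  have hFt : ∀ u ∈ V₀, fderiv ℝ F u (stdb 2 1) = ξ (F u) := by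
    intro u hu
    have h1 := (hflow _ (hmem u hu).2 _ (hsub _ (hmem u hu).1).2).2
    have h2 : HasDerivAt (fun t => F ![u 0, t]) (fderiv ℝ F u (stdb 2 1)) (u 1) :=
      HasFDerivAt.comp_hasDerivAt_of_eq (f := fun t => (![u 0, t] : Pt 2)) (u 1)
        (hFd u hu).hasFDerivAt (hasDerivAt_cons_right (u 0) (u 1)) (hcons u)
    exact h2.unique h1
  have hFγ : ∀ s, F ![s, 0] = γ s := fun s => hφ0 _
  obtain ⟨hcE, hcξ⟩ := hg.cov_flow_out hU hξ hk hξξ (K := K) hF hFU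
    (fun u hu => (hFU' u hu).2.le) hFt hFγ (fun s hs => hgeo s (hsub s hs).1)
    (fun s hs => hγξ s (hsub s hs).1)
  have hE : ContDiffOn ℝ (⊤ : ℕ∞) (fun y => fderiv ℝ F y (stdb 2 0)) V₀ :=
    (hF.fderiv_of_isOpen hV₀ (by simp)).clm_apply contDiffOn_const
  have hξF : ContDiffOn ℝ (⊤ : ℕ∞) (fun y => ξ (F y)) V₀ := hξ.comp hF hFU
  have hE0 : fderiv ℝ F ![s₀, 0] (stdb 2 0) = deriv γ s₀ := by
    have h := HasFDerivAt.comp_hasDerivAt (f := fun s => (![s, 0] : Pt 2)) s₀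
      (hFd _ hu₀).hasFDerivAt (hasDerivAt_cons_left s₀ 0)
    have h' : HasDerivAt γ (fderiv ℝ F ![s₀, 0] (stdb 2 0)) s₀ :=
      h.congr_of_eventuallyEq (Filter.Eventually.of_forall fun s => (hFγ s).symm)
    exact h'.deriv.symm
  have hconn : IsPreconnected V₀ := (convex_ball _ _).isPreconnected
  have hEE : ∀ u ∈ V₀, metB g (F u) (fderiv ℝ F u (stdb 2 0)) (fderiv ℝ F u (stdb 2 0)) = 1 :=
    fun u hu => by
      rw [hg.metB_eq_of_parallel hU hV₀ hconn hF hFU hE hE hcE hcE hu₀ hu, hFγ, hE0, hspeed]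
  have hEξ : ∀ u ∈ V₀, metB g (F u) (fderiv ℝ F u (stdb 2 0)) (ξ (F u)) = 0 :=
    fun u hu => by
      rw [hg.metB_eq_of_parallel hU hV₀ hconn hF hFU hE hξF hcE hcξ hu₀ hu, hFγ, hE0, horth]
  obtain ⟨V, N, hV, hVV₀, huV, hN, hprop⟩ := hg.exists_parallel_normal hU hV₀ hF hFU hE hξF hcE hcξ
    hEE (fun u hu => hunit _ (hFU u hu)) hEξ hu₀
  have hne : ∀ {u : Pt 2} {W : Pt 3}, metB g (F u) W W = 1 → W ≠ 0 := by
    rintro u W h rfl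
    simp at h
  refine ⟨V, F, N, ![s₀, 0], hV, huV, hFγ s₀, hF.mono hVV₀, hN, fun u hu => ?_⟩
  obtain ⟨h1, h2, h3, h4⟩ := hprop u hu
  have hu' := hVV₀ hu
  refine ⟨hFU u hu', ?_, h1, ?_, h4, by rw [hg.metB_symm, h3]⟩
  · rw [hFt u hu']
    exact hg.linearIndependent_pair (hFU u hu') (hne (hEE u hu')) (hne (hunit _ (hFU u hu')))
      (hEξ u hu')
  · rw [Fin.forall_fin_two, hFt u hu']
    exact ⟨h2, h3⟩

end Surface

/-- Theorem 2 (2).  Let `M` be a Riemannian three-manifold carrying a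
unit Killing field `ξ` with associated function `τ` (`∇̃_X ξ = τ (X × ξ)`), and `p ∈ M`.
Then `M` admits a totally geodesic surface through `p` which is everywhere tangent to
`ξ` if and only if there exists a geodesic through `p` on which `τ` vanishes identically
and which is orthogonal to `ξ` at `p`. -/
theorem statement10 (U : Set (Pt 3)) (hU : IsOpen U)
    (g : Met 3) (hg : IsMetricOn U g)
    (ξ : Pt 3 → Pt 3) (hξs : ContDiffOn ℝ (⊤ : ℕ∞) ξ U)
    (hξu : IsUnitOn U g ξ) (hξk : IsKillingOn U g ξ)
    (τ : Pt 3 → ℝ) (hτs : ContDiffOn ℝ (⊤ : ℕ∞) τ U)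
    (hτ : ∀ x ∈ U, ∀ v : Pt 3, covD g ξ x v = τ x • crossG g x v (ξ x))
    (p : Pt 3) (hp : p ∈ U) :
    (∃ S : Hyp 2, S.IsRegular U g ∧ S.TotallyGeodesic g ∧
      (∃ u ∈ S.V, S.F u = p) ∧
      -- the surface is everywhere tangent to `ξ`:
      (∀ u ∈ S.V, minner g (S.F u) (ξ (S.F u)) (S.N u) = 0))
    ↔
    (∃ (a b s₀ : ℝ) (γ : ℝ → Pt 3), s₀ ∈ Ioo a b ∧ γ s₀ = p ∧
      (∀ s ∈ Ioo a b, γ s ∈ U) ∧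
      ContDiffOn ℝ (⊤ : ℕ∞) γ (Ioo a b) ∧
      -- `γ` is a unit-speed geodesic:
      (∀ s ∈ Ioo a b, curveAccel g γ s = 0) ∧
      (∀ s ∈ Ioo a b, minner g (γ s) (vel γ s) (vel γ s) = 1) ∧
      -- `τ` vanishes along `γ`:
      (∀ s ∈ Ioo a b, τ (γ s) = 0) ∧
      -- `γ` is orthogonal to `ξ` at `p`:
      minner g p (vel γ s₀) (ξ p) = 0) := by
  have hξd : ∀ x ∈ U, DifferentiableAt ℝ ξ x := fun x hx =>
    (hξs.contDiffAt (hU.mem_nhds hx)).differentiableAt (by simp)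
  have hunit : ∀ x ∈ U, metB g x (ξ x) (ξ x) = 1 := fun x hx => by
    rw [metB_apply]; exact hξu x hx
  have hk : ∀ x ∈ U, ∀ v w, metB g x (fderiv ℝ ξ x v + gam g x v (ξ x)) w
      + metB g x (fderiv ℝ ξ x w + gam g x w (ξ x)) v = 0 := fun x hx v w => by
    rw [metB_apply, metB_apply, ← covD_eq_cov (hξd x hx), ← covD_eq_cov (hξd x hx)]
    exact hξk x hx v w
  have hτ' : ∀ x ∈ U, ∀ v, fderiv ℝ ξ x v + gam g x v (ξ x) = τ x • crossG g x v (ξ x) :=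
    fun x hx v => by rw [← covD_eq_cov (hξd x hx)]; exact hτ x hx v
  have htwo : (2 : WithTop ℕ∞) ≤ ((⊤ : ℕ∞) : WithTop ℕ∞) := WithTop.coe_le_coe.2 le_top
  have hpair : ∀ (F : Pt 2 → Pt 3) (u : Pt 2),
      ![fderiv ℝ F u (stdb 2 0), fderiv ℝ F u (stdb 2 1)] = fun a => fderiv ℝ F u (stdb 2 a) :=
    fun F u => by ext a; fin_cases a <;> rfl
  constructor
  · rintro ⟨S, ⟨hV, hF, hFU, hli, hN, hNN, hNF⟩, hgeo, ⟨u₀, hu₀, rfl⟩, htan⟩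
    obtain ⟨δ, γ, hδ, hγ0, hγ, h⟩ := hg.exists_geodesic_of_surface hU hξs hunit
      (fun x hx v => by linarith [hk x hx v v]) hτ' hV hF hFU
      (fun u hu => by rw [hpair]; exact hli u hu) hN
      (fun u hu => by rw [metB_apply]; exact hNN u hu)
      (fun u hu a => by rw [metB_apply]; exact hNF u hu a)
      (fun u hu a => by
        rw [← covAlong_eq_cov ((hN.contDiffAt (hV.mem_nhds hu)).differentiableAt (by simp))]
        exact hgeo u hu a)
      (fun u hu => by rw [metB_apply]; exact htan u hu) hu₀
    have hγa : ∀ s ∈ Ioo (-δ) δ, ContDiffAt ℝ (⊤ : ℕ∞) γ s := fun s hs =>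
      hγ.contDiffAt (isOpen_Ioo.mem_nhds hs)
    have hγv : ∀ s ∈ Ioo (-δ) δ, vel γ s = deriv γ s := fun s hs =>
      vel_eq_deriv ((hγa s hs).differentiableAt (by simp))
    have h0 : (0 : ℝ) ∈ Ioo (-δ) δ := ⟨neg_lt_zero.2 hδ, hδ⟩
    refine ⟨-δ, δ, 0, γ, h0, hγ0, fun s hs => (h s hs).1, hγ, fun s hs => ?_, fun s hs => ?_,
      fun s hs => (h s hs).2.2.2.1, ?_⟩
    · rw [curveAccel_eq ((hγa s hs).of_le htwo)]
      exact (h s hs).2.1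
    · rw [hγv s hs, ← metB_apply]
      exact (h s hs).2.2.1
    · rw [hγv 0 h0, ← hγ0, ← metB_apply]
      exact (h 0 h0).2.2.2.2
  · rintro ⟨a, b, s₀, γ, hs₀, rfl, hγU, hγ, hacc, hspeed, hτγ, horth⟩
    have hγa : ∀ s ∈ Ioo a b, ContDiffAt ℝ (⊤ : ℕ∞) γ s := fun s hs =>
      hγ.contDiffAt (isOpen_Ioo.mem_nhds hs)
    have hγv : vel γ s₀ = deriv γ s₀ :=
      vel_eq_deriv ((hγa s₀ hs₀).differentiableAt (by simp))
    obtain ⟨V, F, N, u₀, hV, hu₀, hFu₀, hF, hN, h⟩ :=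
      hg.exists_surface_of_geodesic hU hξs hunit hk
        (fun x hx => by rw [hτ' x hx, crossG_self, smul_zero]) isOpen_Ioo hs₀ hγU hγ
        (fun s hs => by rw [← curveAccel_eq ((hγa s hs).of_le htwo)]; exact hacc s hs)
        (by rw [metB_apply, ← hγv]; exact hspeed s₀ hs₀)
        (fun s hs => by rw [hτ' _ (hγU s hs), hτγ s hs, zero_smul])
        (by rw [metB_apply, ← hγv]; exact horth)
    refine ⟨⟨V, F, N⟩, ⟨hV, hF, fun u hu => (h u hu).1, fun u hu => ?_, hN, fun u hu => ?_,
      fun u hu a => ?_⟩, fun u hu a => ?_, ⟨u₀, hu₀, hFu₀⟩, fun u hu => ?_⟩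
    · have := (h u hu).2.1
      rwa [hpair] at this
    · exact (metB_apply ..).symm.trans (h u hu).2.2.1
    · exact (metB_apply ..).symm.trans ((h u hu).2.2.2.1 a)
    · exact (covAlong_eq_cov ((hN.contDiffAt (hV.mem_nhds hu)).differentiableAt (by simp))
        (stdb 2 a)).trans ((h u hu).2.2.2.2.1 _)
    · exact (metB_apply ..).symm.trans (h u hu).2.2.2.2.2
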